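/- For every natural number m ≥ 2 there exist unique polynomials V_2, …, V_m with rational coefficients, where V_s has degree s−1 and positive leading coefficient, such that B_n = n²/4 + n²/(4·log n) + (n²/2)·∑_{s=2}^{m} (−1)^{s+1}·V_s(log log n)/(s·log^s n) + O(n²·(log log n)^{m+1}/log^{m+1} n) as n → ∞; moreover V_2(x) = x − 7/2. -/

import Mathlib

open Real Polynomial

/-- `nthPrime n` is the `n`-th prime number, with `nthPrime 1 = 2`, `nthPrime 2 = 3`, … -/
noncomputable def nthPrime (n : ℕ) : ℕ := Nat.nth Nat.Prime (n - 1)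

/-- `B n = n·p_n/2 − ∑_{k ≤ n} p_k`, as a real number. -/
noncomputable def B (n : ℕ) : ℝ :=
  (n : ℝ) * (nthPrime n : ℝ) / 2 - ∑ k ∈ Finset.Icc 1 n, (nthPrime k : ℝ)

/-- The family `V : ℕ → ℚ[X]` consists (for indices `2, …, m`) of polynomials of degree
`s − 1` with positive leading coefficient, such that
`B_n = n²/4 + n²/(4·log n) + (n²/2)·∑_{s=2}^{m} (−1)^{s+1}·V_s(log log n)/(s·log^s n)
  + O(n²·(log log n)^{m+1}/log^{m+1} n)`. -/
def IsBFamily (m : ℕ) (V : ℕ → Polynomial ℚ) : Prop :=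
  (∀ s ∈ Finset.Icc 2 m, (V s).natDegree = s - 1 ∧ 0 < (V s).leadingCoeff) ∧
  ∃ C : ℝ, 0 < C ∧ ∃ N : ℕ, ∀ n : ℕ, N ≤ n →
    |B n -
        ((n : ℝ) ^ 2 / 4 + (n : ℝ) ^ 2 / (4 * Real.log n) +
          (n : ℝ) ^ 2 / 2 *
            ∑ s ∈ Finset.Icc 2 m, (-1 : ℝ) ^ (s + 1) *
              (Polynomial.aeval (Real.log (Real.log n)) (V s)) /
                ((s : ℝ) * Real.log n ^ s))| ≤
      C * (n : ℝ) ^ 2 * Real.log (Real.log n) ^ (m + 1) / Real.log n ^ (m + 1)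

namespace BA

/-- telescoping terms for `(s-1) ζ(s)` -/
noncomputable def bt (n : ℕ) (s : ℂ) : ℂ :=
  (s - 1) * ((n + 1 : ℝ) : ℂ) ^ (-s) + ((n + 1 : ℝ) : ℂ) ^ (1 - s) - ((n : ℝ) : ℂ) ^ (1 - s)

lemma norm_cpow_sub_le (n : ℕ) (hn : 1 ≤ n) (s : ℂ) (hs : 0 ≤ s.re) (x y : ℝ)
    (hx : x ∈ Set.Icc (n : ℝ) (n + 1)) (hy : y ∈ Set.Icc (n : ℝ) (n + 1)) :
    ‖(y : ℂ) ^ (-s) - (x : ℂ) ^ (-s)‖ ≤ ‖s‖ * (n : ℝ) ^ (-s.re - 1) := by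
  have hn0 : (0 : ℝ) < n := by exact_mod_cast hn
  by_cases hs0 : s = 0
  · simp [hs0]
  have key := Convex.norm_image_sub_le_of_norm_hasDerivWithin_le (𝕜 := ℝ)
    (f := fun x : ℝ => (x : ℂ) ^ (-s)) (f' := fun x : ℝ => (-s) * (x : ℂ) ^ (-s - 1))
    (s := Set.Icc (n : ℝ) (n + 1)) (C := ‖s‖ * (n : ℝ) ^ (-s.re - 1)) (x := x) (y := y)
    ?_ ?_ (convex_Icc _ _) hx hy
  · refine key.trans ?_
    have : ‖y - x‖ ≤ 1 := by
      rw [Real.norm_eq_abs, abs_le]; constructor <;> linarith [hx.1, hx.2, hy.1, hy.2]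
    have h2 : 0 ≤ ‖s‖ * (n : ℝ) ^ (-s.re - 1) := by positivity
    nlinarith
  · intro t ht
    have : t ≠ 0 := by linarith [ht.1]
    exact (hasDerivAt_ofReal_cpow_const this (neg_ne_zero.mpr hs0)).hasDerivWithinAt
  · intro t ht
    have ht0 : 0 < t := lt_of_lt_of_le hn0 ht.1
    rw [norm_mul, norm_neg, Complex.norm_cpow_eq_rpow_re_of_pos ht0]
    gcongr
    simp only [Complex.sub_re, Complex.neg_re, Complex.one_re]
    exact Real.rpow_le_rpow_of_nonpos hn0 ht.1 (by linarith)

lemma norm_bt_le (n : ℕ) (hn : 1 ≤ n) (s : ℂ) (hs : 0 ≤ s.re) :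
    ‖bt n s‖ ≤ ‖s - 1‖ * (‖s‖ * (n : ℝ) ^ (-s.re - 1)) := by
  have hn0 : (0 : ℝ) < n := by exact_mod_cast hn
  by_cases hs1 : s = 1
  · simp [bt, hs1]
  have hs1' : 1 - s ≠ 0 := by intro h; apply hs1; linear_combination -h
  have key := Convex.norm_image_sub_le_of_norm_hasDerivWithin_le (𝕜 := ℝ)
    (f := fun x : ℝ => (s - 1) * ((n + 1 : ℝ) : ℂ) ^ (-s) * (x : ℂ) + (x : ℂ) ^ (1 - s))
    (f' := fun x : ℝ => (s - 1) * ((n + 1 : ℝ) : ℂ) ^ (-s) * 1 + (1 - s) * (x : ℂ) ^ (1 - s - 1))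
    (s := Set.Icc (n : ℝ) (n + 1)) (C := ‖s - 1‖ * (‖s‖ * (n : ℝ) ^ (-s.re - 1)))
    (x := n) (y := n + 1)
    ?_ ?_ (convex_Icc _ _) (by simp) (by simp)
  · have e : ‖(n + 1 : ℝ) - n‖ = 1 := by simp
    rw [e, mul_one] at key
    refine le_trans (le_of_eq ?_) key
    congr 1
    simp only [bt]; push_cast; ring
  · intro t ht
    have : t ≠ 0 := by linarith [ht.1]
    exact (((hasDerivAt_id (t:ℂ)).comp_ofReal.const_mul _).add
      (hasDerivAt_ofReal_cpow_const this hs1')).hasDerivWithinAt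
  · intro t ht
    have h := norm_cpow_sub_le n hn s hs t (n + 1) ht (by simp)
    have e : (s - 1) * ((n + 1 : ℝ) : ℂ) ^ (-s) * 1 + (1 - s) * (t : ℂ) ^ (1 - s - 1)
      = (s - 1) * (((n + 1 : ℝ) : ℂ) ^ (-s) - (t : ℂ) ^ (-s)) := by
      rw [show 1 - s - 1 = -s by ring]; ring
    rw [e, norm_mul]
    gcongr

lemma differentiable_bt (n : ℕ) (hn : 1 ≤ n) : Differentiable ℂ (bt n) := by
  have hn0 : ((n : ℝ) : ℂ) ≠ 0 := by norm_cast; omega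
  have hn1 : ((n + 1 : ℝ) : ℂ) ≠ 0 := by norm_cast
  intro s
  unfold bt
  have h1 : DifferentiableAt ℂ (fun s : ℂ => ((n + 1 : ℝ) : ℂ) ^ (-s)) s :=
    (differentiableAt_id.neg).const_cpow (Or.inl hn1)
  have h2 : DifferentiableAt ℂ (fun s : ℂ => ((n + 1 : ℝ) : ℂ) ^ (1 - s)) s :=
    (differentiableAt_id.const_sub _).const_cpow (Or.inl hn1)
  have h3 : DifferentiableAt ℂ (fun s : ℂ => ((n : ℝ) : ℂ) ^ (1 - s)) s :=
    (differentiableAt_id.const_sub _).const_cpow (Or.inl hn0)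
  fun_prop

/-- The function `(s-1) ζ(s)`, as a series converging for `Re s > 0`. -/
noncomputable def Zf (s : ℂ) : ℂ := s + ∑' n : ℕ, bt (n + 1) s

lemma summable_bt (s : ℂ) (hs : 0 < s.re) : Summable (fun n : ℕ => bt (n + 1) s) := by
  refine Summable.of_norm_bounded (g := fun n : ℕ => ‖s - 1‖ * (‖s‖ * ((n + 1 : ℕ) : ℝ) ^ (-s.re - 1))) ?_ ?_
  · refine Summable.mul_left _ (Summable.mul_left _ ?_)
    exact (summable_nat_add_iff 1 (f := fun n : ℕ => (n : ℝ) ^ (-s.re - 1))).mpr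
      (Real.summable_nat_rpow.mpr (by linarith))
  · intro n
    exact norm_bt_le (n + 1) (by omega) s hs.le

lemma sum_bt (s : ℂ) (N : ℕ) : ∑ n ∈ Finset.range N, bt (n + 1) s =
    (s - 1) * ∑ n ∈ Finset.range (N + 1), ((n + 1 : ℝ) : ℂ) ^ (-s) + ((N + 1 : ℝ) : ℂ) ^ (1 - s) - s := by
  induction N with
  | zero => simp
  | succ N ih =>
    rw [Finset.sum_range_succ, ih, Finset.sum_range_succ _ (N+1), bt]
    push_cast
    ring

lemma Zf_eq_sum (s : ℂ) (hs : 0 < s.re) (N : ℕ) : Zf s =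
    (s - 1) * ∑ n ∈ Finset.range (N + 1), ((n + 1 : ℝ) : ℂ) ^ (-s) + ((N + 1 : ℝ) : ℂ) ^ (1 - s)
      + ∑' n : ℕ, bt (n + N + 1) s := by
  rw [Zf, ← (summable_bt s hs).sum_add_tsum_nat_add N, sum_bt]
  ring

lemma Zf_eq (s : ℂ) (hs : 1 < s.re) : Zf s = (s - 1) * riemannZeta s := by
  have hs0 : 0 < s.re := by linarith
  have h1 : Filter.Tendsto (fun N : ℕ => ∑ n ∈ Finset.range N, bt (n + 1) s) Filter.atTop
      (nhds (∑' n : ℕ, bt (n + 1) s)) := (summable_bt s hs0).hasSum.tendsto_sum_nat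
  have hsum : Summable (fun n : ℕ => ((n + 1 : ℝ) : ℂ) ^ (-s)) := by
    have := (Complex.summable_one_div_nat_cpow (p := s)).mpr hs
    have := (summable_nat_add_iff 1).mpr this
    refine this.congr fun n => ?_
    rw [Complex.cpow_neg, one_div]; push_cast; rfl
  have hz : ∑' n : ℕ, ((n + 1 : ℝ) : ℂ) ^ (-s) = riemannZeta s := by
    rw [zeta_eq_tsum_one_div_nat_add_one_cpow hs]
    refine tsum_congr fun n => ?_
    rw [Complex.cpow_neg, one_div]; push_cast; rfl
  have h2 : Filter.Tendsto (fun N : ℕ => ∑ n ∈ Finset.range (N+1), ((n + 1 : ℝ) : ℂ) ^ (-s)) Filter.atTop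
      (nhds (riemannZeta s)) := by
    rw [← hz]
    exact (hsum.hasSum.tendsto_sum_nat).comp (Filter.tendsto_add_atTop_nat 1)
  have h3 : Filter.Tendsto (fun N : ℕ => ((N + 1 : ℝ) : ℂ) ^ (1 - s)) Filter.atTop (nhds 0) := by
    rw [tendsto_zero_iff_norm_tendsto_zero]
    have : Filter.Tendsto (fun N : ℕ => ((N : ℝ) + 1) ^ (-(s.re - 1))) Filter.atTop (nhds 0) :=
      (tendsto_rpow_neg_atTop (by linarith)).comp
        (Filter.tendsto_atTop_add_const_right _ _ tendsto_natCast_atTop_atTop)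
    refine this.congr fun N => ?_
    rw [Complex.norm_cpow_eq_rpow_re_of_pos (by positivity)]
    congr 1; simp
  have h4 := ((h2.const_mul (s - 1)).add h3).sub_const s
  have h5 := tendsto_nhds_unique h1 (h4.congr fun N => (sum_bt s N).symm)
  rw [Zf, h5]; ring

lemma differentiableOn_Zf : DifferentiableOn ℂ Zf {s | 0 < s.re} := by
  have hopen : IsOpen {s : ℂ | 0 < s.re} := isOpen_lt continuous_const Complex.continuous_re
  intro s hs
  have hs : 0 < s.re := hs
  -- a neighbourhood
  set c := s.re / 2 with hc
  set R := ‖s‖ + 1 with hR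
  have hUo : IsOpen ({w : ℂ | c < w.re} ∩ Metric.ball 0 R) :=
    (isOpen_lt continuous_const Complex.continuous_re).inter Metric.isOpen_ball
  have hsU : s ∈ ({w : ℂ | c < w.re} ∩ Metric.ball 0 R) := by
    constructor
    · simp [hc]; linarith
    · simp [hR]
  have hd : DifferentiableOn ℂ (fun w => ∑' n : ℕ, bt (n + 1) w)
      ({w : ℂ | c < w.re} ∩ Metric.ball 0 R) := by
    refine Complex.differentiableOn_tsum_of_summable_norm
      (u := fun n : ℕ => (R + 1) * (R * ((n + 1 : ℕ) : ℝ) ^ (-c - 1))) ?_ ?_ hUo ?_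
    · refine Summable.mul_left _ (Summable.mul_left _ ?_)
      exact (summable_nat_add_iff 1 (f := fun n : ℕ => (n : ℝ) ^ (-c - 1))).mpr
        (Real.summable_nat_rpow.mpr (by simp only [hc]; linarith))
    · intro n
      exact (differentiable_bt (n + 1) (by omega)).differentiableOn
    · intro n w hw
      have hwr : c < w.re := hw.1
      have hwn : ‖w‖ < R := by simpa using hw.2
      have hc0 : 0 < c := by simp only [hc]; linarith
      refine (norm_bt_le (n + 1) (by omega) w (by linarith)).trans ?_
      have h1 : ‖w - 1‖ ≤ R + 1 := (norm_sub_le _ _).trans (by simp; linarith)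
      have hn1 : (1 : ℝ) ≤ ((n + 1 : ℕ) : ℝ) := by simp
      gcongr
  have : DifferentiableAt ℂ Zf s :=
    differentiableAt_id.add ((hd s hsU).differentiableAt (hUo.mem_nhds hsU))
  exact this.differentiableWithinAt

lemma Zf_bound (η : ℝ) (hη : 0 < η) (hη2 : η ≤ 1 / 2) : ∃ C : ℝ, 0 < C ∧ ∀ s : ℂ, 1 - η ≤ s.re → s.re ≤ 3 →
    ‖Zf s‖ ≤ C * (1 + |s.im|) ^ (1 + 2 * η) := by
  have hS0 : Summable (fun n : ℕ => (n : ℝ) ^ (-1 - η)) := Real.summable_nat_rpow.mpr (by linarith)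
  have hS : Summable (fun n : ℕ => ((n + 1 : ℕ) : ℝ) ^ (-1 - η)) :=
    (summable_nat_add_iff 1 (f := fun n : ℕ => (n : ℝ) ^ (-1 - η))).mpr hS0
  set S := ∑' n : ℕ, ((n + 1 : ℕ) : ℝ) ^ (-1 - η) with hSdef
  have hSnn : 0 ≤ S := tsum_nonneg fun n => by positivity
  refine ⟨6 * S + 2 + 18 * S, by positivity, ?_⟩
  intro s hs1 hs3
  set τ := 1 + |s.im| with hτ
  have hτ1 : 1 ≤ τ := by simp [hτ]
  have hτ0 : 0 < τ := by linarith
  have hns : ‖s‖ ≤ 3 * τ := by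
    refine (Complex.norm_le_abs_re_add_abs_im s).trans ?_
    have : |s.re| ≤ 3 := abs_le.mpr ⟨by linarith, hs3⟩
    have := abs_nonneg s.im
    simp only [hτ]; linarith
  have hns1 : ‖s - 1‖ ≤ 3 * τ := by
    refine (Complex.norm_le_abs_re_add_abs_im _).trans ?_
    have : |(s - 1).re| ≤ 2 := by
      simp only [Complex.sub_re, Complex.one_re]; exact abs_le.mpr ⟨by linarith, by linarith⟩
    have := abs_nonneg s.im
    have : (s - 1).im = s.im := by simp
    rw [this]
    simp only [hτ]; linarith
  set N := ⌊τ⌋₊ with hN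
  have hNτ : (N : ℝ) ≤ τ := Nat.floor_le hτ0.le
  have hτN : τ ≤ (N : ℝ) + 1 := (Nat.lt_floor_add_one τ).le
  have hN2 : (N : ℝ) + 1 ≤ 2 * τ := by linarith
  have hNpow : ((N : ℝ) + 1) ^ (2 * η) ≤ 2 * τ ^ (2 * η) := by
    calc ((N : ℝ) + 1) ^ (2 * η) ≤ (2 * τ) ^ (2 * η) := by gcongr
      _ = 2 ^ (2 * η) * τ ^ (2 * η) := Real.mul_rpow (by norm_num) hτ0.le
      _ ≤ 2 ^ (1 : ℝ) * τ ^ (2 * η) := by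
          gcongr
          · norm_num
          · linarith
      _ = 2 * τ ^ (2 * η) := by simp
  rw [Zf_eq_sum s (by linarith) N]
  have t1 : ‖∑ n ∈ Finset.range (N + 1), ((n + 1 : ℝ) : ℂ) ^ (-s)‖ ≤ 2 * τ ^ (2 * η) * S := by
    calc _ ≤ ∑ n ∈ Finset.range (N + 1), ‖((n + 1 : ℝ) : ℂ) ^ (-s)‖ := norm_sum_le _ _
      _ ≤ ∑ n ∈ Finset.range (N + 1), (2 * τ ^ (2 * η)) * ((n + 1 : ℕ) : ℝ) ^ (-1 - η) := by
          refine Finset.sum_le_sum fun n hn => ?_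
          have hnN : (n : ℝ) + 1 ≤ N + 1 := by
            have := Finset.mem_range.mp hn
            exact_mod_cast (by omega : n + 1 ≤ N + 1)
          have hn0 : (0 : ℝ) < (n : ℝ) + 1 := by positivity
          rw [Complex.norm_cpow_eq_rpow_re_of_pos (by positivity)]
          calc ((n : ℝ) + 1) ^ (-s).re ≤ ((n : ℝ) + 1) ^ (2 * η + (-1 - η)) := by
                apply Real.rpow_le_rpow_of_exponent_le (by linarith [(Nat.cast_nonneg n : (0:ℝ) ≤ n)])
                simp; linarith
            _ = ((n : ℝ) + 1) ^ (2 * η) * ((n : ℝ) + 1) ^ (-1 - η) := Real.rpow_add hn0 _ _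
            _ ≤ ((N : ℝ) + 1) ^ (2 * η) * ((n : ℝ) + 1) ^ (-1 - η) := by gcongr
            _ ≤ (2 * τ ^ (2 * η)) * ((n : ℝ) + 1) ^ (-1 - η) := by gcongr
            _ = _ := by push_cast; rfl
      _ = (2 * τ ^ (2 * η)) * ∑ n ∈ Finset.range (N + 1), ((n + 1 : ℕ) : ℝ) ^ (-1 - η) := by
          rw [Finset.mul_sum]
      _ ≤ (2 * τ ^ (2 * η)) * S := by
          gcongr
          exact hS.sum_le_tsum _ (fun _ _ => by positivity)
  have t2 : ‖((N + 1 : ℝ) : ℂ) ^ (1 - s)‖ ≤ 2 * τ ^ (2 * η) := by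
    rw [Complex.norm_cpow_eq_rpow_re_of_pos (by positivity)]
    refine le_trans ?_ hNpow
    apply Real.rpow_le_rpow_of_exponent_le (by linarith [(Nat.cast_nonneg N : (0:ℝ) ≤ N)])
    simp; linarith
  have t3 : ‖∑' n : ℕ, bt (n + N + 1) s‖ ≤ 18 * τ ^ 2 * τ ^ (2 * η - 1) * S := by
    have hb : ∀ n : ℕ, ‖bt (n + N + 1) s‖ ≤ (9 * τ ^ 2 * τ ^ (2 * η - 1)) * ((n + N + 1 : ℕ) : ℝ) ^ (-1 - η) := by
      intro n
      have hn0 : (0 : ℝ) < ((n + N + 1 : ℕ) : ℝ) := by positivity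
      have hτn : τ ≤ ((n + N + 1 : ℕ) : ℝ) := by
        push_cast; linarith [(Nat.cast_nonneg n : (0:ℝ) ≤ n)]
      have hsre : 0 ≤ s.re := by linarith
      have hp : ((n + N + 1 : ℕ) : ℝ) ^ (-s.re - 1) ≤ τ ^ (2 * η - 1) * ((n + N + 1 : ℕ) : ℝ) ^ (-1 - η) := by
        calc ((n + N + 1 : ℕ) : ℝ) ^ (-s.re - 1) ≤ ((n + N + 1 : ℕ) : ℝ) ^ ((2 * η - 1) + (-1 - η)) := by
              apply Real.rpow_le_rpow_of_exponent_le (by linarith); linarith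
          _ = ((n + N + 1 : ℕ) : ℝ) ^ (2 * η - 1) * ((n + N + 1 : ℕ) : ℝ) ^ (-1 - η) := Real.rpow_add hn0 _ _
          _ ≤ _ := by
              apply mul_le_mul_of_nonneg_right _ (by positivity)
              exact Real.rpow_le_rpow_of_nonpos hτ0 hτn (by linarith)
      calc _ ≤ ‖s - 1‖ * (‖s‖ * ((n + N + 1 : ℕ) : ℝ) ^ (-s.re - 1)) := norm_bt_le (n + N + 1) (by omega) s hsre
        _ ≤ (3 * τ) * ((3 * τ) * (τ ^ (2 * η - 1) * ((n + N + 1 : ℕ) : ℝ) ^ (-1 - η))) := by gcongr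
        _ = _ := by ring
    have hSN : Summable (fun n : ℕ => ((n + N + 1 : ℕ) : ℝ) ^ (-1 - η)) :=
      (summable_nat_add_iff N (f := fun n : ℕ => ((n + 1 : ℕ) : ℝ) ^ (-1 - η))).mpr hS
    have hle : ∑' n : ℕ, ((n + N + 1 : ℕ) : ℝ) ^ (-1 - η) ≤ S := by
      rw [hSdef, ← hS.sum_add_tsum_nat_add N]
      have : 0 ≤ ∑ n ∈ Finset.range N, ((n + 1 : ℕ) : ℝ) ^ (-1 - η) :=
        Finset.sum_nonneg fun _ _ => by positivity
      linarith
    calc _ ≤ ∑' n : ℕ, (9 * τ ^ 2 * τ ^ (2 * η - 1)) * ((n + N + 1 : ℕ) : ℝ) ^ (-1 - η) :=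
          tsum_of_norm_bounded (hSN.mul_left _).hasSum hb
      _ = (9 * τ ^ 2 * τ ^ (2 * η - 1)) * ∑' n : ℕ, ((n + N + 1 : ℕ) : ℝ) ^ (-1 - η) := tsum_mul_left
      _ ≤ (9 * τ ^ 2 * τ ^ (2 * η - 1)) * S := by gcongr
      _ ≤ 18 * τ ^ 2 * τ ^ (2 * η - 1) * S := by
          have : 0 ≤ τ ^ 2 * τ ^ (2 * η - 1) * S := by positivity
          nlinarith
  have e1 : τ ^ (1 + 2 * η) = τ * τ ^ (2 * η) := by rw [Real.rpow_add hτ0, Real.rpow_one]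
  have e2 : τ ^ 2 * τ ^ (2 * η - 1) = τ ^ (1 + 2 * η) := by
    rw [← Real.rpow_natCast, ← Real.rpow_add hτ0]; congr 1; push_cast; ring
  calc _ ≤ ‖s - 1‖ * ‖∑ n ∈ Finset.range (N + 1), ((n + 1 : ℝ) : ℂ) ^ (-s)‖
        + ‖((N + 1 : ℝ) : ℂ) ^ (1 - s)‖ + ‖∑' n : ℕ, bt (n + N + 1) s‖ := by
        rw [← norm_mul]; exact norm_add₃_le
    _ ≤ (3 * τ) * (2 * τ ^ (2 * η) * S) + 2 * τ ^ (2 * η) + 18 * τ ^ 2 * τ ^ (2 * η - 1) * S := by gcongr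
    _ ≤ (3 * τ) * (2 * τ ^ (2 * η) * S) + 2 * (τ * τ ^ (2 * η)) + 18 * τ ^ 2 * τ ^ (2 * η - 1) * S := by
        have : τ ^ (2 * η) ≤ τ * τ ^ (2 * η) := le_mul_of_one_le_left (by positivity) hτ1
        linarith
    _ = _ := by
        rw [show 18 * τ ^ 2 * τ ^ (2 * η - 1) * S = 18 * (τ ^ 2 * τ ^ (2 * η - 1)) * S by ring, e2, e1]
        ring

lemma Zf_iteratedDeriv_bound (k : ℕ) (η : ℝ) (hη : 0 < η) (hη2 : η ≤ 1 / 2) : ∃ C : ℝ, 0 < C ∧ ∀ s : ℂ,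
    1 ≤ s.re → s.re ≤ 2 → ‖iteratedDeriv k Zf s‖ ≤ C * (1 + |s.im|) ^ (1 + 2 * η) := by
  obtain ⟨C, hC, hb⟩ := Zf_bound η hη hη2
  refine ⟨k.factorial * (C * 2 ^ (1 + 2 * η)) / η ^ k, by positivity, fun s hs1 hs2 => ?_⟩
  have hτ1 : 1 ≤ 1 + |s.im| := by simp
  have := Complex.norm_iteratedDeriv_le_of_forall_mem_sphere_norm_le (c := s) (R := η)
    (C := C * (2 * (1 + |s.im|)) ^ (1 + 2 * η)) (f := Zf) k hη ?_ ?_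
  · refine this.trans (le_of_eq ?_)
    rw [Real.mul_rpow (by norm_num) (by linarith)]
    ring
  · refine DifferentiableOn.diffContOnCl (differentiableOn_Zf.mono ?_)
    intro w hw
    rw [closure_ball _ hη.ne'] at hw
    have h1 : ‖w - s‖ ≤ η := by simpa [dist_eq_norm] using hw
    have h2 : |(w - s).re| ≤ η := (Complex.abs_re_le_norm _).trans h1
    rw [Complex.sub_re, abs_le] at h2
    show 0 < w.re
    linarith
  · intro w hw
    have h1 : ‖w - s‖ = η := by simpa [dist_eq_norm] using hw
    have h2 : |(w - s).re| ≤ η := (Complex.abs_re_le_norm _).trans h1.le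
    have h3 : |(w - s).im| ≤ η := (Complex.abs_im_le_norm _).trans h1.le
    rw [Complex.sub_re, abs_le] at h2
    rw [Complex.sub_im] at h3
    refine (hb w (by linarith) (by linarith)).trans ?_
    gcongr
    have : |w.im| ≤ |s.im| + |w.im - s.im| := by
      have := abs_add_le s.im (w.im - s.im); simpa using this
    linarith

end BA

namespace BA

lemma Zf_one : Zf 1 = 1 := by
  have : ∀ n : ℕ, bt (n+1) 1 = 0 := fun n => by simp [bt]
  simp [Zf, this]

lemma Zf_ne_zero (s : ℂ) (hs : 1 ≤ s.re) : Zf s ≠ 0 := by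
  by_cases h1 : s = 1
  · rw [h1, Zf_one]; exact one_ne_zero
  have hz := riemannZeta_ne_zero_of_one_le_re hs
  have hs1 : s - 1 ≠ 0 := sub_ne_zero.mpr h1
  suffices Zf s = (s - 1) * riemannZeta s by rw [this]; exact mul_ne_zero hs1 hz
  -- continuity from the right
  have hopen : IsOpen {s : ℂ | 0 < s.re} := isOpen_lt continuous_const Complex.continuous_re
  have c1 : ContinuousAt Zf s :=
    ((differentiableOn_Zf s (by show 0 < s.re; linarith)).differentiableAt
      (hopen.mem_nhds (by show 0 < s.re; linarith))).continuousAt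
  have c2 : ContinuousAt (fun w => (w - 1) * riemannZeta w) s :=
    (continuousAt_id.sub continuousAt_const).mul (differentiableAt_riemannZeta h1).continuousAt
  have tl : Filter.Tendsto (fun x : ℝ => s + (x : ℂ)) (nhdsWithin 0 (Set.Ioi 0)) (nhds s) := by
    have : Continuous (fun x : ℝ => s + (x : ℂ)) := by fun_prop
    have h := this.tendsto 0
    simp only [Complex.ofReal_zero, add_zero] at h
    exact h.mono_left nhdsWithin_le_nhds
  have l1 := c1.tendsto.comp tl
  have l2 := c2.tendsto.comp tl
  refine tendsto_nhds_unique l1 (l2.congr' ?_)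
  filter_upwards [self_mem_nhdsWithin] with x hx
  have hx : 0 < x := hx
  simp only [Function.comp]
  rw [Zf_eq]
  simp; linarith

lemma zeta_341 (x : ℝ) (hx : 0 < x) (y : ℝ) :
    1 ≤ ‖riemannZeta (1 + x) ^ 3 * riemannZeta (1 + x + Complex.I * y) ^ 4 *
      riemannZeta (1 + x + 2 * Complex.I * y)‖ := by
  have h := DirichletCharacter.norm_LFunction_product_ge_one (N := 1) 1 hx y
  have e : (1 : DirichletCharacter ℂ 1) ^ 2 = 1 := one_pow 2
  rw [e] at h
  simpa [DirichletCharacter.LFunctionTrivChar, DirichletCharacter.LFunction_modOne_eq] using h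

lemma Zf_341 (x : ℝ) (hx : 0 < x) (y : ℝ) :
    x ^ 3 * |y| ^ 5 ≤ ‖Zf (1 + x)‖ ^ 3 * ‖Zf (1 + x + Complex.I * y)‖ ^ 4 * ‖Zf (1 + x + 2 * Complex.I * y)‖ := by
  have h := zeta_341 x hx y
  rw [Zf_eq _ (by simp; linarith), Zf_eq _ (by simp; linarith), Zf_eq _ (by simp; linarith)]
  simp only [norm_mul, norm_pow] at h ⊢
  have e1 : ‖(1 + (x : ℂ) - 1)‖ = x := by simp [abs_of_pos hx]
  have e2 : |y| ≤ ‖(1 + (x : ℂ) + Complex.I * y - 1)‖ := by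
    refine le_trans (le_of_eq ?_) (Complex.abs_im_le_norm _); simp
  have e3 : |y| ≤ ‖(1 + (x : ℂ) + 2 * Complex.I * y - 1)‖ := by
    refine le_trans ?_ (Complex.abs_im_le_norm _)
    simp [abs_mul]; linarith [abs_nonneg y]
  rw [e1]
  calc x ^ 3 * |y| ^ 5 = x ^ 3 * |y| ^ 4 * |y| * 1 := by ring
    _ ≤ x ^ 3 * ‖(1 + (x : ℂ) + Complex.I * y - 1)‖ ^ 4 * ‖(1 + (x : ℂ) + 2 * Complex.I * y - 1)‖ *
      (‖riemannZeta (1 + x)‖ ^ 3 * ‖riemannZeta (1 + x + Complex.I * y)‖ ^ 4 *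
      ‖riemannZeta (1 + x + 2 * Complex.I * y)‖) := by gcongr
    _ = _ := by ring

lemma Zf_lower_far (ε : ℝ) (hε : 0 < ε) (hε1 : ε ≤ 1) : ∃ c : ℝ, 0 < c ∧ ∀ d : ℝ, 0 < d → ∀ x : ℝ, x ≤ 1 →
    ∀ y : ℝ, 1 ≤ |y| → (d * (1 + |y|) ^ (-(5 * ε / 4))) ^ 4 ≤ x →
      c * d ^ 3 * (1 + |y|) ^ (1 - 4 * ε) ≤ ‖Zf (1 + x + Complex.I * y)‖ := by
  obtain ⟨C, hC, hb⟩ := Zf_bound (ε / 2) (by linarith) (by linarith)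
  obtain ⟨K, hK1, hK⟩ : ∃ K : ℝ, 0 < K ∧ 32 * 2 ^ (1 + ε) * C ^ 4 ≤ K ^ 4 := by
    refine ⟨32 * 2 ^ (1 + ε) * C ^ 4 + 1, by positivity, ?_⟩
    have : 0 ≤ 32 * 2 ^ (1 + ε) * C ^ 4 := by positivity
    exact (le_add_of_nonneg_right zero_le_one).trans (le_self_pow₀ (by linarith) (by norm_num))
  refine ⟨1 / K, by positivity, ?_⟩
  intro d hd x hx1 y hy hdx
  set τ := 1 + |y| with hτ
  have hτ0 : 0 < τ := by linarith
  have hx : 0 < x := lt_of_lt_of_le (by positivity) hdx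
  have h := Zf_341 x hx y
  have b1 : ‖Zf (1 + x)‖ ≤ C := by
    have := hb (1 + x) (by simp; linarith) (by simp; linarith)
    simpa using this
  have b2 : ‖Zf (1 + x + 2 * Complex.I * y)‖ ≤ C * (2 * τ) ^ (1 + ε) := by
    have := hb (1 + x + 2 * Complex.I * y) (by simp; linarith) (by simp; linarith)
    refine this.trans ?_
    have e : (1 + (x:ℂ) + 2 * Complex.I * y).im = 2 * y := by simp
    rw [e, show 1 + 2 * (ε / 2) = 1 + ε by ring, abs_mul, abs_two]
    gcongr
    simp only [hτ]; linarith
  have hy2 : τ / 2 ≤ |y| := by simp only [hτ]; linarith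
  set W := ‖Zf (1 + x + Complex.I * y)‖ with hW
  have h2 : ((d * τ ^ (-(5 * ε / 4))) ^ 4) ^ 3 * (τ / 2) ^ 5 ≤ C ^ 3 * W ^ 4 * (C * (2 * τ) ^ (1 + ε)) := by
    calc _ ≤ x ^ 3 * |y| ^ 5 := by gcongr
      _ ≤ _ := h
      _ ≤ _ := by gcongr
  have h3 : (1 / K * d ^ 3 * τ ^ (1 - 4 * ε)) ^ 4 ≤ W ^ 4 := by
    have e1 : (2 * τ) ^ (1 + ε) = 2 ^ (1 + ε) * τ ^ (1 + ε) := Real.mul_rpow (by norm_num) hτ0.le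
    have e2 : ((d * τ ^ (-(5 * ε / 4))) ^ 4) ^ 3 * (τ / 2) ^ 5
        = (d ^ 3 * τ ^ (1 - 4 * ε)) ^ 4 * τ ^ (1 + ε) / 32 := by
      have r1 : (τ ^ (-(5 * ε / 4))) ^ 12 = τ ^ (-(15 * ε)) := by
        rw [← Real.rpow_natCast, ← Real.rpow_mul hτ0.le]; congr 1; push_cast; ring
      have r2 : (τ ^ (1 - 4 * ε)) ^ 4 = τ ^ (4 - 16 * ε) := by
        rw [← Real.rpow_natCast, ← Real.rpow_mul hτ0.le]; congr 1; push_cast; ring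
      have r3 : τ ^ (-(15 * ε)) * τ ^ 5 = τ ^ (4 - 16 * ε) * τ ^ (1 + ε) := by
        rw [← Real.rpow_natCast, ← Real.rpow_add hτ0, ← Real.rpow_add hτ0]; congr 1; push_cast; ring
      calc _ = d ^ 12 * ((τ ^ (-(5 * ε / 4))) ^ 12 * τ ^ 5) / 32 := by ring
        _ = d ^ 12 * (τ ^ (4 - 16 * ε) * τ ^ (1 + ε)) / 32 := by rw [r1, r3]
        _ = _ := by rw [← r2]; ring
    rw [e2, e1] at h2
    have hp : 0 < τ ^ (1 + ε) := by positivity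
    have h4 : (d ^ 3 * τ ^ (1 - 4 * ε)) ^ 4 ≤ 32 * 2 ^ (1 + ε) * C ^ 4 * W ^ 4 := by
      refine le_of_mul_le_mul_right ?_ hp
      calc _ = 32 * ((d ^ 3 * τ ^ (1 - 4 * ε)) ^ 4 * τ ^ (1 + ε) / 32) := by ring
        _ ≤ 32 * (C ^ 3 * W ^ 4 * (C * (2 ^ (1 + ε) * τ ^ (1 + ε)))) := by gcongr
        _ = _ := by ring
    have h5 : (d ^ 3 * τ ^ (1 - 4 * ε)) ^ 4 ≤ K ^ 4 * W ^ 4 := h4.trans (by gcongr)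
    calc _ = (d ^ 3 * τ ^ (1 - 4 * ε)) ^ 4 / K ^ 4 := by field_simp
      _ ≤ W ^ 4 := by rw [div_le_iff₀ (by positivity)]; linarith
  exact le_of_pow_le_pow_left₀ (by norm_num) (norm_nonneg _) h3

lemma Zf_lower (ε : ℝ) (hε : 0 < ε) (hε1 : ε ≤ 1/4) : ∃ c : ℝ, 0 < c ∧ ∀ s : ℂ, 1 < s.re → s.re ≤ 2 →
    c * (1 + |s.im|) ^ (1 - 4 * ε) ≤ ‖Zf s‖ := by
  have hopen : IsOpen {s : ℂ | 0 < s.re} := isOpen_lt continuous_const Complex.continuous_re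
  obtain ⟨c, hc, hfar⟩ := Zf_lower_far ε hε (by linarith)
  obtain ⟨C, hC, hder⟩ := Zf_iteratedDeriv_bound 1 (ε / 2) (by linarith) (by linarith)
  -- compact part
  obtain ⟨c', hc', hcpt⟩ : ∃ c' : ℝ, 0 < c' ∧ ∀ s : ℂ, 1 ≤ s.re → s.re ≤ 2 → |s.im| ≤ 1 → c' ≤ ‖Zf s‖ := by
    have hK : IsCompact (Set.Icc (1 : ℝ) 2 ×ℂ Set.Icc (-1 : ℝ) 1) := isCompact_Icc.reProdIm isCompact_Icc
    have hne : (Set.Icc (1 : ℝ) 2 ×ℂ Set.Icc (-1 : ℝ) 1).Nonempty :=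
      ⟨1, by simp [Complex.mem_reProdIm]⟩
    have hcont : ContinuousOn (fun s => ‖Zf s‖) (Set.Icc (1 : ℝ) 2 ×ℂ Set.Icc (-1 : ℝ) 1) := by
      refine (differentiableOn_Zf.continuousOn.mono ?_).norm
      intro s hs
      have := (Complex.mem_reProdIm.mp hs).1.1
      show 0 < s.re
      linarith
    obtain ⟨s0, hs0, hmin⟩ := hK.exists_isMinOn hne hcont
    refine ⟨‖Zf s0‖, norm_pos_iff.mpr (Zf_ne_zero s0 (Complex.mem_reProdIm.mp hs0).1.1), ?_⟩
    intro s h1 h2 h3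
    exact hmin (Complex.mem_reProdIm.mpr ⟨⟨h1, h2⟩, abs_le.mp h3⟩)
  obtain ⟨d, hd, hd1, hdC⟩ : ∃ d : ℝ, 0 < d ∧ d ≤ 1 ∧ C * d ≤ c / 2 := by
    refine ⟨min 1 (c / (2 * C)), by positivity, min_le_left _ _, ?_⟩
    calc C * min 1 (c / (2 * C)) ≤ C * (c / (2 * C)) := by gcongr; exact min_le_right _ _
      _ = c / 2 := by field_simp
  refine ⟨min (c' / 2) (c * d ^ 3 / 2), by positivity, ?_⟩
  intro s hs1 hs2
  have hτ1 : 1 ≤ 1 + |s.im| := by simp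
  set τ := 1 + |s.im| with hτ
  have hτ0 : 0 < τ := by linarith
  by_cases hy : |s.im| ≤ 1
  · have h1 : τ ^ (1 - 4 * ε) ≤ 2 := by
      calc τ ^ (1 - 4 * ε) ≤ τ ^ (1 : ℝ) := Real.rpow_le_rpow_of_exponent_le hτ1 (by linarith)
        _ = τ := Real.rpow_one _
        _ ≤ 2 := by simp only [hτ]; linarith
    calc _ ≤ c' / 2 * 2 := by
          gcongr; exact min_le_left _ _
      _ = c' := by ring
      _ ≤ _ := hcpt s hs1.le hs2 hy
  · push Not at hy
    have hmin : min (c' / 2) (c * d ^ 3 / 2) * τ ^ (1 - 4 * ε) ≤ c * d ^ 3 / 2 * τ ^ (1 - 4 * ε) := by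
      gcongr; exact min_le_right _ _
    refine hmin.trans ?_
    have hpos : 0 < c * d ^ 3 * τ ^ (1 - 4 * ε) := by positivity
    set x0 := (d * τ ^ (-(5 * ε / 4))) ^ 4 with hx0
    have hx0pos : 0 < x0 := by positivity
    have hx01 : x0 ≤ 1 := by
      apply pow_le_one₀ (by positivity)
      calc d * τ ^ (-(5 * ε / 4)) ≤ 1 * 1 := by
            gcongr
            exact Real.rpow_le_one_of_one_le_of_nonpos hτ1 (by linarith)
        _ = 1 := one_mul 1
    have hs_eq : ∀ x : ℝ, (⟨1 + x, s.im⟩ : ℂ) = 1 + x + Complex.I * s.im := by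
      intro x; apply Complex.ext <;> simp
    by_cases hbig : x0 ≤ s.re - 1
    · have := hfar d hd (s.re - 1) (by linarith) s.im hy.le hbig
      rw [← hs_eq] at this
      have e : (⟨1 + (s.re - 1), s.im⟩ : ℂ) = s := by apply Complex.ext <;> simp
      rw [e] at this
      linarith
    · push Not at hbig
      have h1 := hfar d hd x0 hx01 s.im hy.le le_rfl
      rw [← hs_eq] at h1
      set s0 : ℂ := ⟨1 + x0, s.im⟩ with hs0
      have hdiff : ‖Zf s0 - Zf s‖ ≤ C * τ ^ (1 + ε) * ‖s0 - s‖ := by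
        refine Convex.norm_image_sub_le_of_norm_deriv_le (𝕜 := ℂ) (s := {w | 1 ≤ w.re ∧ w.re ≤ 2 ∧ w.im = s.im}) ?_ ?_ ?_ ?_ ?_
        · rintro w ⟨hw1, -, -⟩
          exact differentiableOn_Zf.differentiableAt (hopen.mem_nhds (by show 0 < w.re; linarith))
        · rintro w ⟨hw1, hw2, hw3⟩
          have := hder w hw1 hw2
          rw [iteratedDeriv_one, hw3, show 1 + 2 * (ε / 2) = 1 + ε by ring] at this
          exact this
        · rintro w ⟨h1, h2, h3⟩ w' ⟨h1', h2', h3'⟩ a b ha hb hab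
          refine ⟨?_, ?_, ?_⟩
          · simp; nlinarith
          · simp; nlinarith
          · simp [h3, h3', ← add_mul, hab]
        · exact ⟨hs1.le, hs2, rfl⟩
        · exact ⟨by simp [hs0]; linarith, by simp [hs0]; linarith, by simp [hs0]⟩
      have hss : ‖s0 - s‖ ≤ x0 := by
        have e : s0 - s = ((1 + x0 - s.re : ℝ) : ℂ) := by apply Complex.ext <;> simp [hs0]
        rw [e, Complex.norm_real, Real.norm_eq_abs, abs_le]
        constructor <;> linarith
      have hprod : C * τ ^ (1 + ε) * x0 ≤ c * d ^ 3 * τ ^ (1 - 4 * ε) / 2 := by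
        have e : τ ^ (1 + ε) * (τ ^ (-(5 * ε / 4))) ^ 4 = τ ^ (1 - 4 * ε) := by
          rw [← Real.rpow_natCast, ← Real.rpow_mul hτ0.le, ← Real.rpow_add hτ0]; congr 1; push_cast; ring
        calc _ = (C * d) * d ^ 3 * (τ ^ (1 + ε) * (τ ^ (-(5 * ε / 4))) ^ 4) := by rw [hx0]; ring
          _ ≤ (c / 2) * d ^ 3 * (τ ^ (1 + ε) * (τ ^ (-(5 * ε / 4))) ^ 4) := by gcongr
          _ = _ := by rw [e]; ring
      have h2 : ‖Zf s0 - Zf s‖ ≤ c * d ^ 3 * τ ^ (1 - 4 * ε) / 2 :=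
        (hdiff.trans (by gcongr)).trans hprod
      have h3 : ‖Zf s0‖ ≤ ‖Zf s‖ + ‖Zf s0 - Zf s‖ := by
        have := norm_add_le (Zf s) (Zf s0 - Zf s); simpa using this
      linarith

/-- all derivatives are `O(τ^(a+ρ))` on the strip `1 < Re s ≤ 2`. -/
def PB (f : ℂ → ℂ) (a : ℝ) : Prop := ∀ k : ℕ, ∀ ρ : ℝ, 0 < ρ → ∃ C : ℝ, 0 < C ∧ ∀ s : ℂ, 1 < s.re → s.re ≤ 2 →
  ‖iteratedDeriv k f s‖ ≤ C * (1 + |s.im|) ^ (a + ρ)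

lemma PB_div (A G Φ : ℂ → ℂ) (a b : ℝ) (hA : PB A a) (hΦ : PB Φ b)
    (hAd : DifferentiableOn ℂ A {s | 1 < s.re}) (hGd : DifferentiableOn ℂ G {s | 1 < s.re})
    (hAG : ∀ s : ℂ, 1 < s.re → A s * G s = Φ s)
    (hlow : ∀ ρ : ℝ, 0 < ρ → ∃ c : ℝ, 0 < c ∧ ∀ s : ℂ, 1 < s.re → s.re ≤ 2 → c * (1 + |s.im|) ^ (a - ρ) ≤ ‖A s‖) :
    PB G (b - a) := by
  have hopen : IsOpen {s : ℂ | 1 < s.re} := isOpen_lt continuous_const Complex.continuous_re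
  intro k
  induction k using Nat.strong_induction_on with
  | _ k ih =>
  intro ρ hρ
  obtain ⟨c, hc, hlow⟩ := hlow (ρ / 4) (by linarith)
  obtain ⟨CΦ, hCΦ, hΦk⟩ := hΦ k (3 * ρ / 4) (by linarith)
  choose CA hCA hAk using fun i => hA i (ρ / 4) (by linarith)
  have ih' : ∀ j : ℕ, ∃ C : ℝ, 0 < C ∧ (j < k → ∀ s : ℂ, 1 < s.re → s.re ≤ 2 →
      ‖iteratedDeriv j G s‖ ≤ C * (1 + |s.im|) ^ (b - a + ρ / 2)) := by
    intro j
    by_cases hj : j < k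
    · obtain ⟨C, hC, h⟩ := ih j hj (ρ / 2) (by linarith)
      exact ⟨C, hC, fun _ => h⟩
    · exact ⟨1, one_pos, fun h => absurd h hj⟩
  choose CG hCG hGk using ih'
  set S := ∑ i ∈ Finset.range k, (k.choose (i + 1) : ℝ) * CA (i + 1) * CG (k - (i + 1)) with hS
  have hSnn : 0 ≤ S := Finset.sum_nonneg fun i _ => by have := hCA (i+1); have := hCG (k - (i+1)); positivity
  refine ⟨(CΦ + S) / c, by positivity, ?_⟩
  intro s hs1 hs2
  have hτ1 : 1 ≤ 1 + |s.im| := by simp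
  set τ := 1 + |s.im| with hτ
  have hτ0 : 0 < τ := by linarith
  have hmem : {s : ℂ | 1 < s.re} ∈ nhds s := hopen.mem_nhds hs1
  have cA : ContDiffAt ℂ k A s := (hAd.contDiffOn hopen).contDiffAt hmem
  have cG : ContDiffAt ℂ k G s := (hGd.contDiffOn hopen).contDiffAt hmem
  have hL := iteratedDeriv_fun_mul cA cG
  have hcongr : iteratedDeriv k (fun i => A i * G i) s = iteratedDeriv k Φ s := by
    apply Filter.EventuallyEq.iteratedDeriv_eq
    filter_upwards [hmem] with w hw using hAG w hw
  rw [hcongr, Finset.sum_range_succ'] at hL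
  simp only [Nat.choose_zero_right, Nat.cast_one, one_mul, iteratedDeriv_zero, Nat.sub_zero] at hL
  have hnorm : ‖A s‖ * ‖iteratedDeriv k G s‖ ≤ (CΦ + S) * τ ^ (b + 3 * ρ / 4) := by
    rw [← norm_mul]
    have e : A s * iteratedDeriv k G s = iteratedDeriv k Φ s - ∑ i ∈ Finset.range k,
      (k.choose (i + 1) : ℂ) * iteratedDeriv (i + 1) A s * iteratedDeriv (k - (i + 1)) G s := by
      rw [hL]; ring
    rw [e]
    refine (norm_sub_le _ _).trans ?_
    rw [add_mul]
    refine add_le_add (hΦk s hs1 hs2) ?_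
    rw [hS, Finset.sum_mul]
    refine (norm_sum_le _ _).trans (Finset.sum_le_sum fun i hi => ?_)
    have hik := Finset.mem_range.mp hi
    rw [norm_mul, norm_mul, Complex.norm_natCast]
    have e2 : τ ^ (b + 3 * ρ / 4) = τ ^ (a + ρ / 4) * τ ^ (b - a + ρ / 2) := by
      rw [← Real.rpow_add hτ0]; congr 1; ring
    calc _ ≤ (k.choose (i + 1) : ℝ) * (CA (i + 1) * τ ^ (a + ρ / 4)) * (CG (k - (i + 1)) * τ ^ (b - a + ρ / 2)) := by
          have := (hCA (i+1)).le
          gcongr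
          · exact hAk (i + 1) s hs1 hs2
          · exact hGk (k - (i + 1)) (by omega) s hs1 hs2
      _ = _ := by rw [e2]; ring
  have hl := hlow s hs1 hs2
  have hp : 0 < c * τ ^ (a - ρ / 4) := by positivity
  have h3 : c * τ ^ (a - ρ / 4) * ‖iteratedDeriv k G s‖ ≤ (CΦ + S) * τ ^ (b + 3 * ρ / 4) :=
    le_trans (by gcongr) hnorm
  rw [mul_comm, ← le_div_iff₀ hp] at h3
  refine h3.trans (le_of_eq ?_)
  have e2 : τ ^ (b + 3 * ρ / 4) = τ ^ (a - ρ / 4) * τ ^ (b - a + ρ) := by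
      rw [← Real.rpow_add hτ0]; congr 1; ring
  rw [e2]
  field_simp

lemma PB_Zf : PB Zf 1 := by
  intro k ρ hρ
  obtain ⟨C, hC, h⟩ := Zf_iteratedDeriv_bound k (min (1/2) (ρ/2)) (by positivity) (min_le_left _ _)
  refine ⟨C, hC, fun s h1 h2 => (h s h1.le h2).trans ?_⟩
  have := min_le_right (1/2) (ρ/2)
  gcongr
  · simp
  · linarith

lemma PB_Zf' : PB (fun s => - deriv Zf s) 1 := by
  intro k ρ hρ
  obtain ⟨C, hC, h⟩ := PB_Zf (k + 1) ρ hρ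
  refine ⟨C, hC, fun s h1 h2 => ?_⟩
  have := h s h1 h2
  rw [iteratedDeriv_succ'] at this
  rwa [iteratedDeriv_fun_neg, norm_neg]

/-- minus the logarithmic derivative of `Z` -/
noncomputable def Ff (s : ℂ) : ℂ := - deriv Zf s / Zf s

lemma differentiableOn_Ff : DifferentiableOn ℂ Ff {s | 1 < s.re} := by
  have hopen : IsOpen {s : ℂ | 1 < s.re} := isOpen_lt continuous_const Complex.continuous_re
  have h : DifferentiableOn ℂ Zf {s | 1 < s.re} := differentiableOn_Zf.mono (by
    intro s hs; have : 1 < s.re := hs; show 0 < s.re; linarith)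
  exact ((h.deriv hopen).neg).div h (fun s hs => Zf_ne_zero s (le_of_lt hs))

lemma PB_Ff : PB Ff 0 := by
  have h : DifferentiableOn ℂ Zf {s | 1 < s.re} := differentiableOn_Zf.mono (by
    intro s hs; have : 1 < s.re := hs; show 0 < s.re; linarith)
  have := PB_div Zf Ff _ 1 1 PB_Zf PB_Zf' h differentiableOn_Ff ?_ ?_
  · simpa using this
  · intro s hs
    have := Zf_ne_zero s hs.le
    simp only [Ff]; field_simp
  · intro ρ hρ
    obtain ⟨c, hc, h⟩ := Zf_lower (min (1/4) (ρ/4)) (by positivity) (min_le_left _ _)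
    refine ⟨c, hc, fun s h1 h2 => le_trans ?_ (h s h1 h2)⟩
    have := min_le_right (1/4) (ρ/4)
    gcongr
    · simp
    · linarith

lemma PB_lin (c : ℝ) (hc : 0 ≤ c) : PB (fun s => s + c) 1 := by
  intro k ρ hρ
  refine ⟨3 + c, by positivity, fun s h1 h2 => ?_⟩
  have hτ1 : 1 ≤ 1 + |s.im| := by simp
  have hτp : 1 + |s.im| ≤ (1 + |s.im|) ^ (1 + ρ) := by
    conv_lhs => rw [← Real.rpow_one (1 + |s.im|)]
    exact Real.rpow_le_rpow_of_exponent_le hτ1 (by linarith)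
  have hb : ‖iteratedDeriv k (fun s : ℂ => s + c) s‖ ≤ (3 + c) * (1 + |s.im|) := by
    match k with
    | 0 =>
      rw [iteratedDeriv_zero]
      refine (norm_add_le _ _).trans ?_
      have := Complex.norm_le_abs_re_add_abs_im s
      rw [abs_of_pos (by linarith : 0 < s.re)] at this
      simp only [Complex.norm_real, Real.norm_eq_abs, abs_of_nonneg hc]
      nlinarith [abs_nonneg s.im]
    | 1 =>
      rw [iteratedDeriv_one]
      simp
      nlinarith [abs_nonneg s.im]
    | k + 2 =>
      have e : deriv (fun s : ℂ => s + c) = fun _ => 1 := by ext w; simp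
      rw [iteratedDeriv_succ', e, iteratedDeriv_const]
      simp
      positivity
  exact hb.trans (by gcongr)

lemma lin_lower (c : ℝ) (hc : 0 ≤ c) (ρ : ℝ) (hρ : 0 < ρ) : ∃ c' : ℝ, 0 < c' ∧ ∀ s : ℂ, 1 < s.re → s.re ≤ 2 →
    c' * (1 + |s.im|) ^ (1 - ρ) ≤ ‖s + (c : ℂ)‖ := by
  refine ⟨1/2, by norm_num, fun s h1 h2 => ?_⟩
  have hτ1 : 1 ≤ 1 + |s.im| := by simp
  have hτp : (1 + |s.im|) ^ (1 - ρ) ≤ 1 + |s.im| := by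
    conv_rhs => rw [← Real.rpow_one (1 + |s.im|)]
    exact Real.rpow_le_rpow_of_exponent_le hτ1 (by linarith)
  have e1 := Complex.abs_im_le_norm (s + c)
  have e2 := Complex.re_le_norm (s + c)
  simp at e1 e2
  linarith

/-- `H = F/(s(s+1))` -/
noncomputable def Hf (s : ℂ) : ℂ := Ff s / s / (s + 1)

lemma ne_of_re {s : ℂ} (hs : 1 < s.re) : s ≠ 0 ∧ s + 1 ≠ 0 := by
  constructor
  · rintro rfl; simp at hs; linarith
  · intro h
    have := congrArg Complex.re h
    simp at this; linarith

lemma differentiableOn_Hf : DifferentiableOn ℂ Hf {s | 1 < s.re} := by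
  refine (differentiableOn_Ff.div differentiableOn_id ?_).div (differentiableOn_id.add_const _) ?_
  · intro s hs; exact (ne_of_re hs).1
  · intro s hs; exact (ne_of_re hs).2

lemma PB_Hf : PB Hf (-2) := by
  have d1 : DifferentiableOn ℂ (fun s => Ff s / s) {s | 1 < s.re} :=
    differentiableOn_Ff.div differentiableOn_id (fun s hs => (ne_of_re hs).1)
  have h1 : PB (fun s => Ff s / s) (0 - 1) := by
    refine PB_div (fun s => s + ((0 : ℝ) : ℂ)) _ Ff 1 0 (PB_lin 0 le_rfl) PB_Ff (by fun_prop) d1 ?_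
      (lin_lower 0 le_rfl)
    intro s hs
    have := (ne_of_re hs).1
    simp; field_simp
  have h2 : PB Hf (0 - 1 - 1) := by
    refine PB_div (fun s => s + ((1 : ℝ) : ℂ)) _ (fun s => Ff s / s) 1 (0 - 1) (PB_lin 1 zero_le_one) h1 (by fun_prop)
      differentiableOn_Hf ?_ (lin_lower 1 zero_le_one)
    intro s hs
    have h1 := (ne_of_re hs).1
    have h2 := (ne_of_re hs).2
    simp only [Hf, Complex.ofReal_one]; field_simp
  norm_num at h2
  exact h2

end BA

namespace BA
open MeasureTheory

noncomputable def Ek (n : ℕ) (u : ℝ) : ℝ := max (exp u - n) 0 * exp (-(2 * u))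

lemma Ek_nonneg (n : ℕ) (u : ℝ) : 0 ≤ Ek n u := by unfold Ek; positivity

lemma Ek_integral (n : ℕ) (hn : 1 ≤ n) (s : ℂ) (hs : 0 < s.re) :
    Integrable (fun u : ℝ => (Ek n u : ℂ) * Complex.exp (-(s - 1) * u)) ∧
    ∫ u : ℝ, (Ek n u : ℂ) * Complex.exp (-(s - 1) * u) = (n : ℂ) ^ (-s) / s / (s + 1) := by
  have hn0 : (0 : ℝ) < n := by exact_mod_cast hn
  have hnc : (n : ℂ) ≠ 0 := by exact_mod_cast hn0.ne'
  have hs0 : s ≠ 0 := by rintro rfl; simp at hs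
  have hs1 : s + 1 ≠ 0 := by
    intro h
    have := congrArg Complex.re h
    simp at this; linarith
  have r1 : (-s).re < 0 := by simpa using hs
  have r2 : (-(s+1)).re < 0 := by simp; linarith
  have e : (fun u : ℝ => (Ek n u : ℂ) * Complex.exp (-(s - 1) * u)) =
      (Set.Ioi (log n)).indicator (fun u : ℝ => Complex.exp ((-s) * u) - n * Complex.exp ((-(s+1)) * u)) := by
    funext u
    by_cases hu : u ∈ Set.Ioi (log n)
    · rw [Set.indicator_of_mem hu]
      have : (n : ℝ) ≤ exp u := by
        rw [← Real.exp_log hn0]; exact Real.exp_le_exp.mpr (le_of_lt hu)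
      rw [Ek, max_eq_left (by linarith)]
      push_cast
      rw [sub_mul, sub_mul, ← Complex.exp_add, ← Complex.exp_add, mul_assoc, ← Complex.exp_add]
      congr 2
      · ring
      · congr 1; ring
    · rw [Set.indicator_of_notMem hu]
      have hu : u ≤ log n := by simpa using hu
      have : exp u ≤ n := by
        rw [← Real.exp_log hn0]; exact Real.exp_le_exp.mpr hu
      rw [Ek, max_eq_right (by linarith)]; simp
  have i1 := integrableOn_exp_mul_complex_Ioi r1 (log n)
  have i2 := (integrableOn_exp_mul_complex_Ioi r2 (log n)).const_mul (n : ℂ)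
  rw [e]
  refine ⟨(i1.sub i2).integrable_indicator measurableSet_Ioi, ?_⟩
  rw [integral_indicator measurableSet_Ioi, integral_sub i1 i2, integral_const_mul,
    integral_exp_mul_complex_Ioi r1, integral_exp_mul_complex_Ioi r2]
  have e1 : Complex.exp (-s * ((log n : ℝ) : ℂ)) = (n : ℂ) ^ (-s) := by
    rw [Complex.cpow_def_of_ne_zero hnc, Complex.natCast_log, mul_comm]
  have e2 : Complex.exp (-(s + 1) * ((log n : ℝ) : ℂ)) = (n : ℂ) ^ (-s) / n := by
    rw [← e1, neg_add, add_mul, Complex.exp_add]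
    rw [show -1 * ((log n : ℝ) : ℂ) = -((log n : ℝ) : ℂ) by ring, Complex.exp_neg, ← Complex.ofReal_exp,
      Real.exp_log hn0, div_eq_mul_inv]
    simp
  rw [e1, e2]
  field_simp
  ring

/-- Main term kernel -/
noncomputable def Ek2 (u : ℝ) : ℝ := (max (exp u - 1) 0) ^ 2 / 2 * exp (-(2 * u))

lemma Ek2_integral (s : ℂ) (hs : 1 < s.re) :
    Integrable (fun u : ℝ => (Ek2 u : ℂ) * Complex.exp (-(s - 1) * u)) ∧
    ∫ u : ℝ, (Ek2 u : ℂ) * Complex.exp (-(s - 1) * u) = 1 / (s - 1) / s / (s + 1) := by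
  have hs0 : s ≠ 0 := (ne_of_re hs).1
  have hs1 : s + 1 ≠ 0 := (ne_of_re hs).2
  have hs2 : s - 1 ≠ 0 := by
    intro h
    have := congrArg Complex.re h
    simp at this; linarith
  have r0 : (-(s-1)).re < 0 := by simp; linarith
  have r1 : (-s).re < 0 := by simp; linarith
  have r2 : (-(s+1)).re < 0 := by simp; linarith
  have e : (fun u : ℝ => (Ek2 u : ℂ) * Complex.exp (-(s - 1) * u)) =
      (Set.Ioi (0:ℝ)).indicator (fun u : ℝ => (1/2 : ℂ) * Complex.exp ((-(s-1)) * u) - Complex.exp ((-s) * u)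
        + (1/2 : ℂ) * Complex.exp ((-(s+1)) * u)) := by
    funext u
    by_cases hu : u ∈ Set.Ioi (0:ℝ)
    · rw [Set.indicator_of_mem hu]
      have : 1 ≤ exp u := Real.one_le_exp (le_of_lt hu)
      rw [Ek2, max_eq_left (by linarith)]
      have a1 : Complex.exp (-s * u) = Complex.exp (-(s-1) * u) * Complex.exp (-u) := by
        rw [← Complex.exp_add]; congr 1; ring
      have a2 : Complex.exp (-(s + 1) * u) = Complex.exp (-(s-1) * u) * Complex.exp (-u) ^ 2 := by
        rw [← Complex.exp_nat_mul, ← Complex.exp_add]; congr 1; push_cast; ring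
      have a3 : Complex.exp (-(2 * u)) = Complex.exp (-u) ^ 2 := by
        rw [← Complex.exp_nat_mul]; congr 1; push_cast; ring
      have a4 : Complex.exp u * Complex.exp (-u) = 1 := by rw [← Complex.exp_add]; simp
      push_cast
      rw [a1, a2, a3]
      linear_combination (1/2 * Complex.exp (-(s - 1) * u) * (Complex.exp u * Complex.exp (-u) + 1)
        - Complex.exp (-(s - 1) * u) * Complex.exp (-u)) * a4
    · rw [Set.indicator_of_notMem hu]
      have hu : u ≤ 0 := by simpa using hu
      have : exp u ≤ 1 := Real.exp_le_one_iff.mpr hu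
      rw [Ek2, max_eq_right (by linarith)]; simp
  have i0 := (integrableOn_exp_mul_complex_Ioi r0 0).const_mul (1/2 : ℂ)
  have i1 := integrableOn_exp_mul_complex_Ioi r1 0
  have i2 := (integrableOn_exp_mul_complex_Ioi r2 0).const_mul (1/2 : ℂ)
  rw [e]
  have i01 : IntegrableOn (fun u : ℝ => (1/2 : ℂ) * Complex.exp ((-(s-1)) * u) - Complex.exp ((-s) * u))
    (Set.Ioi 0) := i0.sub i1
  have i012 : IntegrableOn (fun u : ℝ => (1/2 : ℂ) * Complex.exp ((-(s-1)) * u) - Complex.exp ((-s) * u)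
        + (1/2 : ℂ) * Complex.exp ((-(s+1)) * u)) (Set.Ioi 0) := i01.add i2
  refine ⟨i012.integrable_indicator measurableSet_Ioi, ?_⟩
  rw [integral_indicator measurableSet_Ioi, integral_add i01 i2]
  rw [integral_sub i0 i1, integral_const_mul, integral_const_mul,
    integral_exp_mul_complex_Ioi r0, integral_exp_mul_complex_Ioi r1, integral_exp_mul_complex_Ioi r2]
  simp only [Complex.ofReal_zero, mul_zero, Complex.exp_zero, neg_div_neg_eq]
  field_simp
  ring


/-- `ψ₁(x) = Σ_n Λ(n) (x-n)_+`. -/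
noncomputable def psi1 (x : ℝ) : ℝ := ∑' n : ℕ, ArithmeticFunction.vonMangoldt n * max (x - n) 0

lemma psi1_eq (x : ℝ) (N : ℕ) (h : x ≤ N) : psi1 x = ∑ n ∈ Finset.range N, ArithmeticFunction.vonMangoldt n * max (x - n) 0 := by
  rw [psi1, tsum_eq_sum]
  intro n hn
  have : (N : ℝ) ≤ n := by exact_mod_cast (by simpa using hn : N ≤ n)
  rw [max_eq_right (by linarith)]; simp

lemma continuous_psi1 : Continuous psi1 := by
  rw [continuous_iff_continuousAt]
  intro x
  obtain ⟨N, hN⟩ := exists_nat_gt x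
  have : psi1 =ᶠ[nhds x] fun x => ∑ n ∈ Finset.range N, ArithmeticFunction.vonMangoldt n * max (x - n) 0 := by
    filter_upwards [eventually_lt_nhds hN] with y hy using psi1_eq y N hy.le
  refine ContinuousAt.congr ?_ this.symm
  fun_prop

lemma psi_eq' (x : ℝ) (hx : 0 ≤ x) (N : ℕ) (h : x < N) :
    Chebyshev.psi x = ∑ n ∈ Finset.range N, ArithmeticFunction.vonMangoldt n * (if (n : ℝ) ≤ x then 1 else 0) := by
  rw [Chebyshev.psi]
  simp only [mul_ite, mul_one, mul_zero]
  rw [← Finset.sum_filter]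
  refine Finset.sum_subset_zero_on_sdiff ?_ ?_ (fun _ _ => rfl)
  · intro n hn
    simp only [Finset.mem_Ioc, Finset.mem_filter, Finset.mem_range] at hn ⊢
    have : (n : ℝ) ≤ x := (Nat.le_floor_iff hx).mp hn.2
    exact ⟨by exact_mod_cast this.trans_lt h, this⟩
  · intro n hn
    simp only [Finset.mem_Ioc, Finset.mem_filter, Finset.mem_range, Finset.mem_sdiff] at hn
    have : n ≤ ⌊x⌋₊ := Nat.le_floor hn.1.2
    have : n = 0 := by by_contra h0; exact hn.2 ⟨by omega, this⟩
    simp [this]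

lemma psi1_diff (x d : ℝ) (hx : 0 ≤ x) (hd : 0 ≤ d) :
    d * Chebyshev.psi x ≤ psi1 (x + d) - psi1 x ∧ psi1 (x + d) - psi1 x ≤ d * Chebyshev.psi (x + d) := by
  obtain ⟨N, hN⟩ := exists_nat_gt (x + d)
  rw [psi1_eq _ N hN.le, psi1_eq x N (by linarith), psi_eq' x hx N (by linarith),
    psi_eq' (x+d) (by linarith) N hN, ← Finset.sum_sub_distrib, Finset.mul_sum, Finset.mul_sum]
  constructor
  · refine Finset.sum_le_sum fun n _ => ?_
    have h0 : 0 ≤ ArithmeticFunction.vonMangoldt n := ArithmeticFunction.vonMangoldt_nonneg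
    rw [← mul_sub, mul_left_comm]
    refine mul_le_mul_of_nonneg_left ?_ h0
    split_ifs with h
    · rw [max_eq_left (by linarith), max_eq_left (by linarith)]; linarith
    · push Not at h
      rw [max_eq_right (by linarith : x - n ≤ 0)]
      have := le_max_right (x + d - n) 0
      linarith
  · refine Finset.sum_le_sum fun n _ => ?_
    have h0 : 0 ≤ ArithmeticFunction.vonMangoldt n := ArithmeticFunction.vonMangoldt_nonneg
    rw [← mul_sub, mul_left_comm]
    refine mul_le_mul_of_nonneg_left ?_ h0
    split_ifs with h
    · rw [max_eq_left (by linarith)]; have := le_max_left (x - n) 0; linarith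
    · push Not at h
      rw [max_eq_right (by linarith), max_eq_right (by linarith)]; linarith

lemma psi1_bound : ∃ C : ℝ, 0 < C ∧ ∀ x : ℝ, 0 ≤ x → 0 ≤ psi1 x ∧ psi1 x ≤ C * x ^ 2 := by
  refine ⟨log 4 + 4, by positivity, fun x hx => ?_⟩
  have h := psi1_diff 0 x le_rfl hx
  have h0 : psi1 0 = 0 := by rw [psi1_eq 0 0 (by simp)]; simp
  rw [h0, zero_add, sub_zero, Chebyshev.psi_eq_zero_of_lt_two (by norm_num)] at h
  have h2 := Chebyshev.psi_le_const_mul_self hx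
  refine ⟨by linarith, h.2.trans ?_⟩
  nlinarith

/-- the smoothed remainder -/
noncomputable def hh (u : ℝ) : ℝ := psi1 (exp u) * exp (-(2*u)) - Ek2 u

lemma continuous_hh : Continuous hh := by
  have := continuous_psi1
  unfold hh Ek2
  fun_prop

lemma Ff_eq (s : ℂ) (hs : 1 < s.re) : Ff s = LSeries (fun n => (ArithmeticFunction.vonMangoldt n : ℂ)) s - 1 / (s - 1) := by
  rw [ArithmeticFunction.LSeries_vonMangoldt_eq_deriv_riemannZeta_div hs, Ff]
  have hopen : IsOpen {s : ℂ | 1 < s.re} := isOpen_lt continuous_const Complex.continuous_re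
  have hz : riemannZeta s ≠ 0 := riemannZeta_ne_zero_of_one_le_re hs.le
  have hs1 : s ≠ 1 := by rintro rfl; simp at hs
  have hs2 : s - 1 ≠ 0 := sub_ne_zero.mpr hs1
  have hd : deriv Zf s = riemannZeta s + (s - 1) * deriv riemannZeta s := by
    have e : Zf =ᶠ[nhds s] fun s => (s - 1) * riemannZeta s := by
      filter_upwards [hopen.mem_nhds hs] with w hw using Zf_eq w hw
    rw [e.deriv_eq]
    have := ((hasDerivAt_id s).sub_const 1).mul (differentiableAt_riemannZeta hs1).hasDerivAt
    have := this.deriv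
    simp only [id, one_mul] at this
    exact this
  rw [hd, Zf_eq s hs]
  field_simp
  ring

lemma hh_integral (s : ℂ) (hs : 1 < s.re) :
    ∫ u : ℝ, (hh u : ℂ) * Complex.exp (-(s - 1) * u) = Hf s := by
  have hsr : (1 : ℝ) < s.re := hs
  set F : ℕ → ℝ → ℂ := fun n u => (ArithmeticFunction.vonMangoldt n : ℂ) * ((Ek n u : ℂ) * Complex.exp (-(s - 1) * u)) with hF
  have hFi : ∀ n, Integrable (F n) := by
    intro n
    rcases Nat.eq_zero_or_pos n with rfl | hn
    · simp [hF]
    · exact (Ek_integral n hn s (by linarith)).1.const_mul _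
  have hsr' : 1 < ((s.re : ℂ)).re := by simpa using hs
  have hnorm : ∀ n, ∫ u, ‖F n u‖ = ‖LSeries.term (fun n => (ArithmeticFunction.vonMangoldt n : ℂ)) s n‖ * (1 / s.re / (s.re + 1)) := by
    intro n
    rcases Nat.eq_zero_or_pos n with rfl | hn
    · simp [hF]
    have h := (Ek_integral n hn (s.re : ℂ) (by simp; linarith)).2
    have h0 : 0 ≤ ArithmeticFunction.vonMangoldt n := ArithmeticFunction.vonMangoldt_nonneg
    have e1 : ∀ u : ℝ, ‖F n u‖ = ArithmeticFunction.vonMangoldt n * (Ek n u * exp (-(s.re - 1) * u)) := by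
      intro u
      simp only [hF]
      rw [norm_mul, norm_mul, Complex.norm_real, Complex.norm_real, Complex.norm_exp, Real.norm_of_nonneg h0,
        Real.norm_of_nonneg (Ek_nonneg n u)]
      congr 3
      simp
    simp_rw [e1]
    rw [integral_const_mul]
    have e2 : ∫ u : ℝ, Ek n u * exp (-(s.re - 1) * u) = (n : ℝ) ^ (-s.re) / s.re / (s.re + 1) := by
      have : ((∫ u : ℝ, Ek n u * exp (-(s.re - 1) * u) : ℝ) : ℂ) = ((n : ℝ) ^ (-s.re) / s.re / (s.re + 1) : ℝ) := by
        rw [← integral_complex_ofReal]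
        push_cast
        rw [h]
        congr 2
        rw [Complex.ofReal_cpow (by positivity)]
        simp
      exact_mod_cast this
    rw [e2, LSeries.norm_term_eq, if_neg (by omega), Complex.norm_real, Real.norm_of_nonneg h0,
      Real.rpow_neg (by positivity)]
    ring
  have hsum : Summable fun n => ∫ u, ‖F n u‖ := by
    simp_rw [hnorm]
    exact (ArithmeticFunction.LSeriesSummable_vonMangoldt hs).norm.mul_right _
  have H := hasSum_integral_of_summable_integral_norm hFi hsum
  have hval : ∀ n, ∫ u, F n u = LSeries.term (fun n => (ArithmeticFunction.vonMangoldt n : ℂ)) s n * (1 / s / (s + 1)) := by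
    intro n
    rcases Nat.eq_zero_or_pos n with rfl | hn
    · simp [hF]
    simp only [hF]
    rw [integral_const_mul, (Ek_integral n hn s (by linarith)).2, LSeries.term_of_ne_zero (by omega), Complex.cpow_neg]
    ring
  have H2 : HasSum (fun n => ∫ u, F n u) (LSeries (fun n => (ArithmeticFunction.vonMangoldt n : ℂ)) s * (1 / s / (s + 1))) := by
    simp_rw [hval]
    exact (ArithmeticFunction.LSeriesSummable_vonMangoldt hs).hasSum.mul_right _
  have e3 : ∀ u : ℝ, ∑' n, F n u = (psi1 (exp u) * exp (-(2*u)) : ℝ) * Complex.exp (-(s - 1) * u) := by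
    intro u
    simp only [hF, ← mul_assoc]
    rw [tsum_mul_right]
    congr 1
    rw [psi1, ← tsum_mul_right, Complex.ofReal_tsum]
    congr 1; ext n; rw [Ek]; push_cast; ring
  have H3 := H.unique H2
  simp_rw [e3] at H3
  have hintg : Integrable (fun u : ℝ => (psi1 (exp u) * exp (-(2*u)) : ℝ) * Complex.exp (-(s - 1) * u)) := by
    -- dominated by exp decay: bounded support and bounded psi1
    obtain ⟨C, hC, hb⟩ := psi1_bound
    have r0 : (-(s-1)).re < 0 := by simp; linarith
    have i0' : IntegrableOn (fun u : ℝ => C * ‖Complex.exp (-(s - 1) * u)‖) (Set.Ioi 0) :=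
      (integrableOn_exp_mul_complex_Ioi r0 0).norm.const_mul C
    have i0 := i0'.integrable_indicator measurableSet_Ioi
    refine i0.mono' ?_ ?_
    · have := continuous_psi1
      apply Continuous.aestronglyMeasurable
      fun_prop
    · refine Filter.Eventually.of_forall fun u => ?_
      by_cases hu : u ∈ Set.Ioi (0:ℝ)
      · rw [Set.indicator_of_mem hu, norm_mul]
        refine mul_le_mul_of_nonneg_right ?_ (norm_nonneg _)
        rw [Complex.norm_real, Real.norm_of_nonneg (mul_nonneg (hb _ (exp_pos u).le).1 (exp_pos _).le)]
        calc _ ≤ C * exp u ^ 2 * exp (-(2*u)) := by gcongr; exact (hb _ (exp_pos u).le).2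
          _ = C := by
            rw [← Real.exp_nat_mul, mul_assoc, ← Real.exp_add]; simp
      · rw [Set.indicator_of_notMem hu]
        have hu : u ≤ 0 := by simpa using hu
        have h1 : exp u ≤ 1 := Real.exp_le_one_iff.mpr hu
        have : psi1 (exp u) = 0 := by
          rw [psi1_eq _ 1 (by simpa using h1)]; simp
        simp [this]
  have hE2 := Ek2_integral s hs
  have e4 : ∀ u : ℝ, (hh u : ℂ) * Complex.exp (-(s - 1) * u) =
      (psi1 (exp u) * exp (-(2*u)) : ℝ) * Complex.exp (-(s - 1) * u) - (Ek2 u : ℂ) * Complex.exp (-(s - 1) * u) := by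
    intro u; rw [hh]; push_cast; ring
  simp_rw [e4]
  rw [integral_sub hintg hE2.1, H3, hE2.2, Hf, Ff_eq s hs]
  ring

lemma hh_bound : ∃ C : ℝ, 0 < C ∧ ∀ u : ℝ, |hh u| ≤ C := by
  obtain ⟨C, hC, hb⟩ := psi1_bound
  refine ⟨C + 1/2, by positivity, fun u => ?_⟩
  have e : exp u ^ 2 * exp (-(2*u)) = 1 := by
    rw [← Real.exp_nat_mul, ← Real.exp_add]; simp
  have hp := hb (exp u) (exp_pos u).le
  have h1 : 0 ≤ psi1 (exp u) * exp (-(2*u)) := mul_nonneg hp.1 (exp_pos _).le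
  have h2 : psi1 (exp u) * exp (-(2*u)) ≤ C := by
    calc _ ≤ C * exp u ^ 2 * exp (-(2*u)) := by gcongr; exact hp.2
      _ = C := by rw [mul_assoc, e, mul_one]
  have h3 : 0 ≤ Ek2 u := by unfold Ek2; positivity
  have h4 : Ek2 u ≤ 1/2 := by
    have : max (exp u - 1) 0 ≤ exp u := max_le (by linarith) (exp_pos u).le
    calc Ek2 u ≤ (exp u) ^ 2 / 2 * exp (-(2*u)) := by unfold Ek2; gcongr
      _ = 1/2 := by linear_combination e / 2
  rw [hh, abs_le]
  constructor <;> linarith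

end BA

namespace BA
open MeasureTheory FourierTransform

noncomputable def Gl (η : ℝ) (t : ℝ) : ℂ := Hf (1 + η + 2 * π * Complex.I * t)

lemma Gl_iter (η : ℝ) (hη : 0 < η) (k : ℕ) :
    iteratedDeriv k (Gl η) = fun t : ℝ => (2 * π * Complex.I) ^ k * iteratedDeriv k Hf (1 + η + 2 * π * Complex.I * t) := by
  have hopen : IsOpen {s : ℂ | 1 < s.re} := isOpen_lt continuous_const Complex.continuous_re
  induction k with
  | zero => simp; rfl
  | succ k ih =>
    rw [iteratedDeriv_succ, ih]
    funext t
    have hmem : (1 + η + 2 * π * Complex.I * t : ℂ) ∈ {s : ℂ | 1 < s.re} := by simp [hη]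
    have hd : DifferentiableAt ℂ (iteratedDeriv k Hf) (1 + η + 2 * π * Complex.I * t) := by
      rw [iteratedDeriv_eq_iterate]
      exact (AnalyticAt.iterated_deriv (differentiableOn_Hf.analyticAt (hopen.mem_nhds hmem)) k).differentiableAt
    have h1 : HasDerivAt (fun t : ℝ => (1 + η + 2 * π * Complex.I * t : ℂ)) (2 * π * Complex.I) t := by
      have := ((Complex.ofRealCLM.hasDerivAt (x := t)).const_mul (2 * π * Complex.I : ℂ)).const_add (1 + η : ℂ)
      simpa using this
    have h2 := (HasDerivAt.comp t hd.hasDerivAt h1).const_mul ((2 * π * Complex.I : ℂ) ^ k)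
    have := h2.deriv
    simp only [Function.comp_def] at this
    rw [this, iteratedDeriv_succ]
    ring

lemma Gl_contDiff (η : ℝ) (hη : 0 < η) (N : ℕ) : ContDiff ℝ N (Gl η) := by
  have hopen : IsOpen {s : ℂ | 1 < s.re} := isOpen_lt continuous_const Complex.continuous_re
  rw [contDiff_iff_contDiffAt]
  intro t
  have hmem : (1 + η + 2 * π * Complex.I * t : ℂ) ∈ {s : ℂ | 1 < s.re} := by simp [hη]
  have h1 : ContDiffAt ℂ N Hf (1 + η + 2 * π * Complex.I * t) :=
        (differentiableOn_Hf.contDiffOn hopen).contDiffAt (hopen.mem_nhds hmem)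
  have h2 : ContDiffAt ℝ N (fun t : ℝ => (1 + η + 2 * π * Complex.I * t : ℂ)) t := by
    have : ContDiff ℝ N (fun t : ℝ => (t : ℂ)) := Complex.ofRealCLM.contDiff
    fun_prop
  exact (h1.restrict_scalars ℝ).comp t h2

lemma Gl_bound (k : ℕ) : ∃ C : ℝ, 0 < C ∧ ∀ η : ℝ, 0 < η → η ≤ 1 → ∀ t : ℝ,
    ‖iteratedDeriv k (Gl η) t‖ ≤ C * (1 + ‖t‖) ^ (-(3/2 : ℝ)) := by
  obtain ⟨C, hC, h⟩ := PB_Hf k (1/2) (by norm_num)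
  refine ⟨(2 * π) ^ k * C, by positivity, fun η hη hη1 t => ?_⟩
  rw [Gl_iter η hη]
  simp only [norm_mul, norm_pow]
  have e : ‖(2:ℂ)‖ * ‖(π:ℂ)‖ * ‖Complex.I‖ = 2 * π := by
    simp [abs_of_pos Real.pi_pos]
  rw [e, mul_assoc ((2 * π) ^ k) C]
  gcongr
  refine (h (1 + η + 2 * π * Complex.I * t) (by simp [hη]) (by simp; linarith)).trans ?_
  norm_num
  refine mul_le_mul_of_nonneg_left ?_ hC.le
  rw [Real.rpow_le_rpow_iff_of_neg (by positivity) (by positivity) (by norm_num)]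
  rw [abs_of_pos Real.pi_pos]
  have := Real.pi_gt_three
  nlinarith [abs_nonneg t]

lemma Gl_integrable (η : ℝ) (hη : 0 < η) (hη1 : η ≤ 1) (k : ℕ) : Integrable (iteratedDeriv k (Gl η)) := by
  obtain ⟨C, hC, h⟩ := Gl_bound k
  have i : Integrable (fun t : ℝ => C * (1 + ‖t‖) ^ (-(3/2 : ℝ))) :=
    (integrable_one_add_norm (by norm_num)).const_mul C
  refine i.mono' ?_ (Filter.Eventually.of_forall (h η hη hη1))
  exact ((Gl_contDiff η hη k).continuous_iteratedDeriv k le_rfl).aestronglyMeasurable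

lemma fe_fourier (η : ℝ) (hη : 0 < η) : 𝓕 (fun u : ℝ => (hh u * exp (-(η * u)) : ℂ)) = Gl η := by
  funext t
  rw [Real.fourier_real_eq_integral_exp_smul, Gl, ← hh_integral _ (by simp [hη])]
  congr 1
  funext u
  rw [smul_eq_mul, mul_left_comm]
  push_cast
  rw [← Complex.exp_add]
  congr 2
  ring

lemma hh_zero (u : ℝ) (hu : u ≤ 0) : hh u = 0 := by
  have h1 : exp u ≤ 1 := Real.exp_le_one_iff.mpr hu
  have : psi1 (exp u) = 0 := by
    rw [psi1_eq _ 1 (by simpa using h1)]; simp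
  rw [hh, this, Ek2, max_eq_right (by linarith)]; simp

lemma fe_integrable (η : ℝ) (hη : 0 < η) : Integrable (fun u : ℝ => (hh u * exp (-(η * u)) : ℂ)) := by
  obtain ⟨C, hC, hb⟩ := hh_bound
  have r0 : (-(η : ℂ)).re < 0 := by simp [hη]
  have i0' : IntegrableOn (fun u : ℝ => C * ‖Complex.exp (-(η:ℂ) * u)‖) (Set.Ioi 0) :=
      (integrableOn_exp_mul_complex_Ioi r0 0).norm.const_mul C
  have i0 := i0'.integrable_indicator measurableSet_Ioi
  refine i0.mono' ?_ (Filter.Eventually.of_forall fun u => ?_)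
  · have := continuous_hh
    apply Continuous.aestronglyMeasurable
    fun_prop
  · by_cases hu : u ∈ Set.Ioi (0:ℝ)
    · rw [Set.indicator_of_mem hu, norm_mul, Complex.norm_real]
      gcongr
      · exact hb u
      · apply le_of_eq; push_cast; rw [neg_mul]
    · rw [Set.indicator_of_notMem hu, hh_zero u (by simpa using hu)]; simp

lemma hh_decay (k : ℕ) : ∃ C : ℝ, 0 < C ∧ ∀ u : ℝ, 0 < u → |hh u| * u ^ k ≤ C := by
  obtain ⟨C, hC, h⟩ := Gl_bound k
  have i : Integrable (fun t : ℝ => C * (1 + ‖t‖) ^ (-(3/2 : ℝ))) :=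
    (integrable_one_add_norm (by norm_num)).const_mul C
  set I := ∫ t : ℝ, C * (1 + ‖t‖) ^ (-(3/2 : ℝ)) with hI
  have hI0 : 0 ≤ I := integral_nonneg fun t => by positivity
  have key : ∀ η : ℝ, 0 < η → η ≤ 1 → ∀ u : ℝ, 0 < u → |hh u| * exp (-(η * u)) * u ^ k ≤ I := by
    intro η hη hη1 u hu
    have hG0 : Integrable (Gl η) := by simpa using Gl_integrable η hη hη1 0
    have inv := (fe_integrable η hη).fourierInv_fourier_eq (v := u) (by rw [fe_fourier η hη]; exact hG0) (by
      have := continuous_hh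
      fun_prop)
    rw [fe_fourier η hη, Real.fourierInv_eq_fourier_neg] at inv
    have hd := Real.fourier_iteratedDeriv (f := Gl η) (N := (k : ℕ∞)) (n := k) (Gl_contDiff η hη k)
      (fun n _ => Gl_integrable η hη hη1 n) le_rfl
    have hd := congrFun hd (-u)
    simp only [inv] at hd
    have h1 : ‖𝓕 (iteratedDeriv k (Gl η)) (-u)‖ ≤ I := by
      rw [Real.fourier_real_eq_integral_exp_smul]
      refine (norm_integral_le_integral_norm _).trans ?_
      refine integral_mono_of_nonneg (Filter.Eventually.of_forall fun t => norm_nonneg _) i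
        (Filter.Eventually.of_forall fun t => ?_)
      show ‖_ • _‖ ≤ _
      rw [norm_smul, Complex.norm_exp_ofReal_mul_I, one_mul]
      exact h η hη hη1 t
    rw [hd, norm_smul, norm_pow] at h1
    have e1 : u ≤ ‖(2 * π * Complex.I * ((-u : ℝ) : ℂ))‖ := by
      simp only [norm_mul, Complex.norm_real, Complex.norm_I, Complex.norm_ofNat, norm_neg, Real.norm_eq_abs]
      rw [abs_of_pos Real.pi_pos, abs_of_pos hu]
      nlinarith [Real.pi_gt_three]
    have e2 : u ^ k ≤ ‖(2 * π * Complex.I * ((-u : ℝ) : ℂ))‖ ^ k := by gcongr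
    refine le_trans ?_ h1
    rw [mul_comm]
    gcongr
    apply le_of_eq
    rw [norm_mul, Complex.norm_real, Complex.norm_real, Real.norm_of_nonneg (exp_pos _).le, Real.norm_eq_abs]
  refine ⟨I + 1, by linarith, fun u hu => ?_⟩
  have ht : Filter.Tendsto (fun η : ℝ => |hh u| * exp (-(η * u)) * u ^ k) (nhdsWithin 0 (Set.Ioi 0))
      (nhds (|hh u| * u ^ k)) := by
    have : Continuous (fun η : ℝ => |hh u| * exp (-(η * u)) * u ^ k) := by fun_prop
    have := (this.tendsto 0).mono_left (nhdsWithin_le_nhds (s := Set.Ioi 0))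
    simpa using this
  have : |hh u| * u ^ k ≤ I := by
    refine le_of_tendsto ht ?_
    have : Set.Ioc (0:ℝ) 1 ∈ nhdsWithin (0:ℝ) (Set.Ioi 0) := Ioc_mem_nhdsGT one_pos
    filter_upwards [this] with η hη using key η hη.1 hη.2 u hu
  linarith

end BA

namespace BA

lemma log_pow_le_sqrt (A : ℕ) : ∃ C : ℝ, 0 < C ∧ ∀ x : ℝ, 1 ≤ x → log x ^ A ≤ C * √x := by
  refine ⟨(2 * (A + 1)) ^ A, by positivity, fun x hx => ?_⟩
  have h0 : 0 ≤ log x := log_nonneg hx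
  have h := Real.log_le_rpow_div (x := x) (by linarith) (ε := 1 / (2 * (A + 1))) (by positivity)
  have hx1 : 1 ≤ x ^ ((1:ℝ) / (2 * (A + 1))) := Real.one_le_rpow hx (by positivity)
  calc log x ^ A ≤ (x ^ ((1:ℝ) / (2 * (A + 1))) / (1 / (2 * (A + 1)))) ^ A := by gcongr
    _ = (2 * (A + 1)) ^ A * (x ^ ((1:ℝ) / (2 * (A + 1)))) ^ A := by rw [← mul_pow]; congr 1; field_simp
    _ ≤ (2 * (A + 1)) ^ A * (x ^ ((1:ℝ) / (2 * (A + 1)))) ^ (A + 1) := by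
        gcongr; simp
    _ = _ := by
        rw [← Real.rpow_natCast (x ^ _), ← Real.rpow_mul (by linarith), Real.sqrt_eq_rpow]
        congr 2; push_cast; field_simp

lemma psi1_pnt (k : ℕ) : ∃ C : ℝ, 0 < C ∧ ∀ x : ℝ, 1 < x →
    |psi1 x - (x - 1) ^ 2 / 2| ≤ C * x ^ 2 / log x ^ k := by
  obtain ⟨C, hC, h⟩ := hh_decay k
  refine ⟨C, hC, fun x hx => ?_⟩
  have hl : 0 < log x := log_pos hx
  have h1 := h (log x) hl
  have e : hh (log x) = (psi1 x - (x - 1) ^ 2 / 2) / x ^ 2 := by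
    rw [hh, Ek2, exp_neg, mul_comm 2 (log x), exp_mul, exp_log (by linarith), max_eq_left (by linarith)]
    norm_num
    field_simp
  rw [e, abs_div, abs_of_pos (by positivity : 0 < x ^ 2)] at h1
  rw [le_div_iff₀ (by positivity)]
  have hx2 : 0 < x ^ 2 := by positivity
  calc _ = |psi1 x - (x - 1) ^ 2 / 2| / x ^ 2 * log x ^ k * x ^ 2 := by field_simp
    _ ≤ _ := by gcongr

lemma psi_pnt (A : ℕ) : ∃ C : ℝ, 0 < C ∧ ∀ x : ℝ, 4 ≤ x → |Chebyshev.psi x - x| ≤ C * x / log x ^ A := by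
  obtain ⟨C, hC, h⟩ := psi1_pnt (2 * A)
  obtain ⟨C1, hC1, hlog⟩ := log_pow_le_sqrt A
  refine ⟨1 + 2 * C * (4 + 1 + 2 ^ (2 * A)) + C1, by positivity, fun x hx => ?_⟩
  have hl1 : 1 ≤ log x := by
    rw [Real.le_log_iff_exp_le (by linarith)]
    have := Real.exp_one_lt_d9; linarith
  have hl0 : 0 < log x := by linarith
  have hlA : 1 ≤ log x ^ A := one_le_pow₀ hl1
  set M := log x ^ A with hM
  set d := x / (2 * M) with hd
  have hd0 : 0 < d := by positivity
  have hdx : d ≤ x / 2 := by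
    rw [hd]; gcongr; linarith
  have hMM : log x ^ (2 * A) = M * M := by rw [hM, ← pow_add]; ring_nf
  have hdM : d * M = x / 2 := by rw [hd]; field_simp
  have E0 := h x (by linarith)
  have E1 := h (x + d) (by linarith)
  have E2 := h (x - d) (by linarith)
  rw [hMM] at E0
  have E1' : |psi1 (x + d) - (x + d - 1) ^ 2 / 2| ≤ 4 * C * x ^ 2 / (M * M) := by
    refine E1.trans ?_
    rw [← hMM]
    have : log x ≤ log (x + d) := log_le_log (by linarith) (by linarith)
    calc _ ≤ C * (2 * x) ^ 2 / log x ^ (2 * A) := by gcongr; linarith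
      _ = _ := by ring
  have E2' : |psi1 (x - d) - (x - d - 1) ^ 2 / 2| ≤ 2 ^ (2 * A) * C * x ^ 2 / (M * M) := by
    refine E2.trans ?_
    rw [← hMM]
    have : log x / 2 ≤ log (x - d) := by
      have h1 : log x / 2 = log (√x) := by rw [Real.log_sqrt (by linarith)]
      rw [h1]
      apply log_le_log (by positivity)
      have h2 : √x ≤ x / 2 := by
        rw [Real.sqrt_le_left (by linarith)]; nlinarith
      linarith
    calc _ ≤ C * x ^ 2 / (log x / 2) ^ (2 * A) := by
          have : 0 ≤ x - d := by linarith
          gcongr; linarith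
      _ = _ := by rw [div_pow]; field_simp
  obtain ⟨u1, u2⟩ := psi1_diff x d (by linarith) hd0.le
  obtain ⟨l1, l2⟩ := psi1_diff (x - d) d (by linarith) hd0.le
  rw [sub_add_cancel] at l1 l2
  have key : x ^ 2 / (M * M) = 2 * d * (x / M) := by rw [hd]; field_simp
  have hxM : d ≤ x / M := by rw [hd]; gcongr; linarith
  have hpos : 0 < 2 * d * (x / M) := by positivity
  have hxM1 : 1 ≤ x / M + 1 := by have : 0 < x / M := by positivity
                                  linarith
  rw [abs_le] at E0 E1' E2'
  rw [mul_div_assoc, key] at E0 E1' E2'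
  rw [mul_div_assoc]
  set P := (2:ℝ) ^ (2 * A)
  have hP : 1 ≤ P := one_le_pow₀ (by norm_num)
  set q := x / M
  have hq : 0 < q := by positivity
  have hu : d * (Chebyshev.psi x - x) ≤ d * ((1 + 2 * C * (4 + 1 + P)) * q) := by
    have : 0 ≤ d * (C * q * P) := by positivity
    have h7 : 0 ≤ d * (C * q) := by positivity
    have h8 := mul_le_mul_of_nonneg_left hxM hd0.le
    have h9 : 0 ≤ d * q := by positivity
    linarith
  have hl : d * (x - Chebyshev.psi x) ≤ d * ((1 + 2 * C * (4 + 1 + P)) * q + 1) := by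
    have : 0 ≤ d * (C * q * P) := by positivity
    have h7 : 0 ≤ d * (C * q) := by positivity
    have h8 := mul_le_mul_of_nonneg_left hxM hd0.le
    have h9 : 0 ≤ d * q := by positivity
    linarith
  have hu' := le_of_mul_le_mul_left hu hd0
  have hl' := le_of_mul_le_mul_left hl hd0
  have h1q : 1 ≤ C1 * q := by
    have := hlog x (by linarith)
    have hs : √x ≤ x := by rw [Real.sqrt_le_left (by linarith)]; nlinarith
    rw [← mul_div_assoc, le_div_iff₀ (by positivity), one_mul]
    exact this.trans (by gcongr)
  have h10 : 0 ≤ (1 + 2 * C * (4 + 1 + P)) * q := by positivity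
  rw [abs_le, add_mul _ C1]
  constructor <;> linarith

lemma theta_pnt (A : ℕ) : ∃ C : ℝ, 0 < C ∧ ∀ x : ℝ, 2 ≤ x → |Chebyshev.theta x - x| ≤ C * x / log x ^ A := by
  obtain ⟨C, hC, h⟩ := psi_pnt A
  obtain ⟨C1, hC1, hlog⟩ := log_pow_le_sqrt (A + 1)
  refine ⟨C + 2 * C1 + (log 4 + 5) * log 4 ^ A, by positivity, fun x hx => ?_⟩
  have hl : 0 < log x := log_pos (by linarith)
  have hx0 : 0 < x := by linarith
  have e : (C + 2 * C1 + (log 4 + 5) * log 4 ^ A) * x / log x ^ A = C * x / log x ^ A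
    + 2 * C1 * x / log x ^ A + ((log 4 + 5) * log 4 ^ A) * x / log x ^ A := by ring
  have p1 : 0 ≤ C * x / log x ^ A := by positivity
  have p2 : 0 ≤ 2 * C1 * x / log x ^ A := by positivity
  have p3 : 0 ≤ ((log 4 + 5) * log 4 ^ A) * x / log x ^ A := by positivity
  rw [e]
  rcases le_or_gt 4 x with h4 | h4
  · have h1 := h x h4
    have h2 := Chebyshev.psi_sub_theta_le (x := x) (by linarith)
    have h3 := Chebyshev.theta_le_psi x
    have h5 : 2 * √x * log x ≤ 2 * C1 * x / log x ^ A := by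
      rw [le_div_iff₀ (by positivity)]
      have := hlog x (by linarith)
      calc 2 * √x * log x * log x ^ A = 2 * √x * log x ^ (A + 1) := by ring
        _ ≤ 2 * √x * (C1 * √x) := by gcongr
        _ = 2 * C1 * (√x * √x) := by ring
        _ = _ := by rw [Real.mul_self_sqrt hx0.le]
    rw [abs_le] at h1 ⊢
    constructor <;> linarith
  · have h1 := Chebyshev.psi_le_const_mul_self hx0.le
    have h3 := Chebyshev.theta_le_psi x
    have h2 := Chebyshev.theta_nonneg x
    have h5 : (log 4 + 5) * x ≤ ((log 4 + 5) * log 4 ^ A) * x / log x ^ A := by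
      rw [le_div_iff₀ (by positivity)]
      have : log x ^ A ≤ log 4 ^ A := by gcongr
      have h0 : 0 < (log 4 + 5) * x := by positivity
      nlinarith
    have h6 : 0 < log 4 * x := by positivity
    rw [abs_le]
    constructor <;> nlinarith

/-- `c_{r,k} = k!/(r+1)^{k+1}` -/
noncomputable def cc (r k : ℕ) : ℝ := (k.factorial : ℝ) / (r + 1) ^ (k + 1)

noncomputable def Pm (r K : ℕ) (x : ℝ) : ℝ := x ^ (r + 1) * ∑ k ∈ Finset.range K, cc r k / log x ^ (k + 1)

lemma Pm_deriv (r K : ℕ) (x : ℝ) (hx : 1 < x) :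
    HasDerivAt (Pm r (K + 1)) (x ^ r / log x - (K + 1) * cc r K * (x ^ r / log x ^ (K + 2))) x := by
  have hl : 0 < log x := log_pos hx
  have hx0 : 0 < x := by linarith
  have hterm : ∀ k : ℕ, HasDerivAt (fun x => x ^ (r + 1) * (cc r k / log x ^ (k + 1)))
      ((r + 1) * cc r k * (x ^ r / log x ^ (k + 1)) - (k + 1) * cc r k * (x ^ r / log x ^ (k + 2))) x := by
    intro k
    have h1 := (hasDerivAt_pow (r + 1) x)
    have h2 := ((hasDerivAt_log hx0.ne').pow (k + 1))
    have h3 := h1.mul (((hasDerivAt_const x (cc r k)).div h2 (pow_ne_zero _ hl.ne')))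
    refine h3.congr_deriv ?_
    simp
    field_simp
    ring
  induction K with
  | zero =>
    have := hterm 0
    unfold Pm
    simp only [zero_add, Finset.sum_range_one]
    refine this.congr_deriv ?_
    simp [cc]; field_simp
  | succ K ih =>
    have e : Pm r (K + 1 + 1) = fun x => Pm r (K + 1) x + x ^ (r + 1) * (cc r (K+1) / log x ^ (K + 1 + 1)) := by
      funext y; simp only [Pm]; rw [Finset.sum_range_succ _ (K+1)]; ring
    rw [e]
    refine (ih.add (hterm (K + 1))).congr_deriv ?_
    have : (r + 1) * cc r (K + 1) = (K + 1) * cc r K := by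
      simp only [cc, Nat.factorial_succ]; push_cast; field_simp; ring
    rw [this]
    push_cast
    ring

end BA

namespace BA
open MeasureTheory

lemma int_log_bound (r j : ℕ) : ∃ C : ℝ, 0 < C ∧ ∀ x : ℝ, 2 ≤ x →
    ∫ t in (2:ℝ)..x, t ^ r / log t ^ j ≤ C * x ^ (r + 1) / log x ^ j := by
  obtain ⟨C1, hC1, hlog⟩ := log_pow_le_sqrt (j + 1)
  have hl2 : 0 < log 2 := log_pos (by norm_num)
  refine ⟨2 ^ j + C1 / log 2 ^ j, by positivity, fun x hx => ?_⟩
  have hx0 : 0 < x := by linarith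
  have hl : 0 < log x := log_pos (by linarith)
  set a := x ^ r * (2 ^ j / log x ^ j) with ha
  set b := x ^ r * (√x / log 2 ^ j) with hb
  have ci : ContinuousOn (fun t : ℝ => t ^ r / log t ^ j) (Set.uIcc 2 x) := by
    intro t ht
    rw [Set.uIcc_of_le hx] at ht
    have h0 : t ≠ 0 := by linarith [ht.1]
    have : log t ^ j ≠ 0 := pow_ne_zero _ (log_pos (by linarith [ht.1])).ne'
    exact ContinuousAt.continuousWithinAt (by fun_prop)
  have ci2 : ContinuousOn (fun t : ℝ => a + b * t⁻¹) (Set.uIcc 2 x) := by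
    intro t ht
    rw [Set.uIcc_of_le hx] at ht
    have h0 : t ≠ 0 := by linarith [ht.1]
    exact ContinuousAt.continuousWithinAt (by fun_prop (disch := assumption))
  have h1 : ∫ t in (2:ℝ)..x, t ^ r / log t ^ j ≤ ∫ t in (2:ℝ)..x, (a + b * t⁻¹) := by
    refine intervalIntegral.integral_mono_on hx ci.intervalIntegrable ci2.intervalIntegrable ?_
    intro t ht
    have ht0 : 0 < t := by linarith [ht.1]
    have hlt : log 2 ≤ log t := log_le_log (by norm_num) ht.1
    have hlt0 : 0 < log t := by linarith
    have hA : 0 ≤ 2 ^ j / log x ^ j := by positivity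
    have hB : 0 ≤ √x / log 2 ^ j * t⁻¹ := by positivity
    have key : 1 / log t ^ j ≤ 2 ^ j / log x ^ j + √x / log 2 ^ j * t⁻¹ := by
      rcases le_or_gt t (√x) with h | h
      · have : 1 / log t ^ j ≤ √x / log 2 ^ j * t⁻¹ := by
          calc 1 / log t ^ j ≤ 1 / log 2 ^ j := by gcongr
            _ = t / log 2 ^ j * t⁻¹ := by field_simp
            _ ≤ _ := by gcongr
        linarith
      · have h3 : log x / 2 ≤ log t := by
          rw [← Real.log_sqrt hx0.le]; exact log_le_log (by positivity) h.le
        have : 1 / log t ^ j ≤ 2 ^ j / log x ^ j := by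
          calc 1 / log t ^ j ≤ 1 / (log x / 2) ^ j := by gcongr
            _ = _ := by rw [div_pow]; field_simp
        linarith
    calc t ^ r / log t ^ j = t ^ r * (1 / log t ^ j) := by ring
      _ ≤ x ^ r * (2 ^ j / log x ^ j + √x / log 2 ^ j * t⁻¹) := by gcongr; exact ht.2
      _ = _ := by rw [ha, hb]; ring
  refine h1.trans ?_
  rw [intervalIntegral.integral_add (by simp)
    ((ci2.sub continuousOn_const).congr (g := fun t => b * t⁻¹) (fun t _ => by simp) (f := fun t => a + b * t⁻¹ - a)).intervalIntegrable,
    intervalIntegral.integral_const, intervalIntegral.integral_const_mul, integral_inv_of_pos (by norm_num) hx0]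
  have hlx : log (x / 2) ≤ log x := log_le_log (by linarith) (by linarith)
  have hb0 : 0 ≤ b := by positivity
  have ha0 : 0 ≤ a := by positivity
  have e1 : a * x = 2 ^ j * x ^ (r + 1) / log x ^ j := by rw [ha]; ring
  have e2 : b * log x ≤ C1 / log 2 ^ j * x ^ (r + 1) / log x ^ j := by
    rw [le_div_iff₀ (by positivity)]
    calc b * log x * log x ^ j = x ^ r * (√x / log 2 ^ j) * log x ^ (j + 1) := by rw [hb]; ring
      _ ≤ x ^ r * (√x / log 2 ^ j) * (C1 * √x) := by gcongr; exact hlog x (by linarith)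
      _ = C1 / log 2 ^ j * x ^ r * (√x * √x) := by ring
      _ = _ := by rw [Real.mul_self_sqrt hx0.le]; ring
  have e3 : (2 ^ j + C1 / log 2 ^ j) * x ^ (r + 1) / log x ^ j =
    2 ^ j * x ^ (r + 1) / log x ^ j + C1 / log 2 ^ j * x ^ (r + 1) / log x ^ j := by ring
  rw [e3, smul_eq_mul]
  nlinarith

noncomputable def Sr (r : ℕ) (x : ℝ) : ℝ := ∑ p ∈ Finset.Icc 0 ⌊x⌋₊ with p.Prime, (p : ℝ) ^ r

noncomputable def fr (r : ℕ) (t : ℝ) : ℝ := t ^ r / log t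
noncomputable def fr' (r : ℕ) (t : ℝ) : ℝ := t ^ r / t * (r / log t - 1 / log t ^ 2)

lemma fr_deriv (r : ℕ) (t : ℝ) (ht : 1 < t) : HasDerivAt (fr r) (fr' r t) t := by
  have hl : 0 < log t := log_pos ht
  have ht0 : 0 < t := by linarith
  have := (hasDerivAt_pow r t).div (hasDerivAt_log ht0.ne') hl.ne'
  refine this.congr_deriv ?_
  unfold fr'
  rcases Nat.eq_zero_or_pos r with rfl | hr
  · simp; field_simp
  · obtain ⟨q, rfl⟩ : ∃ q, r = q + 1 := ⟨r - 1, by omega⟩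
    simp
    field_simp
    ring

lemma fr'_cont (r : ℕ) (x : ℝ) : ContinuousOn (fr' r) (Set.Icc 2 x) := by
  intro t ht
  have h0 : t ≠ 0 := by linarith [ht.1]
  have h1 : log t ≠ 0 := (log_pos (by linarith [ht.1])).ne'
  have h2 : log t ^ 2 ≠ 0 := pow_ne_zero _ h1
  unfold fr'
  exact ContinuousAt.continuousWithinAt (by fun_prop (disch := assumption))

lemma Sr_abel (r : ℕ) (x : ℝ) (hx : 2 ≤ x) :
    Sr r x = fr r x * Chebyshev.theta x - ∫ t in (2:ℝ)..x, fr' r t * Chebyshev.theta t := by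
  let a : ℕ → ℝ := fun n => if n.Prime then log n else 0
  have ha : ∀ y : ℝ, ∑ k ∈ Finset.Icc 0 ⌊y⌋₊, a k = Chebyshev.theta y := by
    intro y
    rw [Chebyshev.theta_eq_sum_Icc, Finset.sum_filter]
  have h := sum_mul_eq_sub_integral_mul₁ a (f := fr r) (by simp [a]) (by simp [a]) x ?_ ?_
  · rw [ha] at h
    have e : Sr r x = ∑ k ∈ Finset.Icc 0 ⌊x⌋₊, fr r k * a k := by
      rw [Sr, Finset.sum_filter]
      refine Finset.sum_congr rfl fun n hn => ?_
      split_ifs with hp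
      · have : 0 < log n := log_pos (by exact_mod_cast hp.one_lt)
        simp only [a, if_pos hp, fr]; field_simp
      · simp [a, hp]
    rw [e, h, intervalIntegral.integral_of_le hx]
    congr 1
    refine setIntegral_congr_fun measurableSet_Ioc fun t ht => ?_
    have ht1 : 1 < t := by linarith [ht.1]
    simp only [ha, (fr_deriv r t ht1).deriv]
  · intro t ht
    exact (fr_deriv r t (by linarith [ht.1])).differentiableAt
  · refine ((fr'_cont r x).integrableOn_Icc).congr_fun ?_ measurableSet_Icc
    intro t ht
    exact (fr_deriv r t (by linarith [ht.1])).deriv.symm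

theorem Sr_asymp (r K : ℕ) : ∃ C : ℝ, 0 < C ∧ ∀ x : ℝ, 2 ≤ x →
    |Sr r x - Pm r (K + 1) x| ≤ C * x ^ (r + 1) / log x ^ (K + 2) := by
  obtain ⟨C1, hC1, hθ⟩ := theta_pnt (K + 1)
  obtain ⟨C2, hC2, hI⟩ := int_log_bound r (K + 2)
  obtain ⟨C3, hC3, hlog⟩ := log_pow_le_sqrt (K + 2)
  have hl2 : 0 < log 2 := log_pos (by norm_num)
  set D := |2 * fr r 2 - Pm r (K + 1) 2| with hD
  set M := (r + 1 / log 2) * C1 + (K + 1) * cc r K with hM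
  have hcc : 0 ≤ cc r K := by unfold cc; positivity
  refine ⟨C1 + D * C3 + M * C2, by positivity, fun x hx => ?_⟩
  have hx0 : 0 < x := by linarith
  have hl : 0 < log x := log_pos (by linarith)
  set G : ℝ → ℝ := fun t => (K + 1) * cc r K * (t ^ r / log t ^ (K + 2)) with hG
  have cG : ContinuousOn (fun t : ℝ => t ^ r / log t ^ (K + 2)) (Set.uIcc 2 x) := by
    intro t ht
    rw [Set.uIcc_of_le hx] at ht
    have h0 : t ≠ 0 := by linarith [ht.1]
    have : log t ^ (K + 2) ≠ 0 := pow_ne_zero _ (log_pos (by linarith [ht.1])).ne'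
    exact ContinuousAt.continuousWithinAt (by fun_prop (disch := assumption))
  have cG' : ContinuousOn G (Set.uIcc 2 x) := continuousOn_const.mul cG
  have cf : ContinuousOn (fr' r) (Set.uIcc 2 x) := by rw [Set.uIcc_of_le hx]; exact fr'_cont r x
  have ftc : ∫ t in (2:ℝ)..x, (t * fr' r t + G t) = (x * fr r x - Pm r (K + 1) x) - (2 * fr r 2 - Pm r (K + 1) 2) := by
    refine intervalIntegral.integral_eq_sub_of_hasDerivAt (f := fun t => t * fr r t - Pm r (K + 1) t) ?_
      ((continuousOn_id.mul cf).add cG').intervalIntegrable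
    intro t ht
    rw [Set.uIcc_of_le hx] at ht
    have ht1 : 1 < t := by linarith [ht.1]
    refine (((hasDerivAt_id t).mul (fr_deriv r t ht1)).sub (Pm_deriv r K t ht1)).congr_deriv ?_
    simp only [hG, id, fr]; ring
  have iθ : IntervalIntegrable (fun t => fr' r t * Chebyshev.theta t) volume 2 x :=
    (Chebyshev.theta_mono.intervalIntegrable (a := 2) (b := x)).continuousOn_mul cf
  have i2 : IntervalIntegrable (fun t => t * fr' r t + G t) volume 2 x :=
    ((continuousOn_id.mul cf).add cG').intervalIntegrable
  have main : Sr r x - Pm r (K + 1) x = fr r x * (Chebyshev.theta x - x) + (2 * fr r 2 - Pm r (K + 1) 2)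
      + ∫ t in (2:ℝ)..x, ((t * fr' r t + G t) - fr' r t * Chebyshev.theta t) := by
    rw [intervalIntegral.integral_sub i2 iθ, ftc, Sr_abel r x hx]; ring
  have bI : |∫ t in (2:ℝ)..x, ((t * fr' r t + G t) - fr' r t * Chebyshev.theta t)| ≤
      ∫ t in (2:ℝ)..x, M * (t ^ r / log t ^ (K + 2)) := by
    rw [← Real.norm_eq_abs]
    refine intervalIntegral.norm_integral_le_of_norm_le hx (Filter.Eventually.of_forall fun t ht => ?_)
      (continuousOn_const.mul cG).intervalIntegrable
    have ht2 : 2 ≤ t := ht.1.le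
    have ht0 : 0 < t := by linarith
    have hlt : log 2 ≤ log t := log_le_log (by norm_num) ht2
    have hlt0 : 0 < log t := by linarith
    have e : (t * fr' r t + G t) - fr' r t * Chebyshev.theta t = G t - fr' r t * (Chebyshev.theta t - t) := by ring
    rw [e, Real.norm_eq_abs]
    have hGt : |G t| = G t := abs_of_nonneg (by simp only [hG]; positivity)
    have hf : |fr' r t| ≤ t ^ r / t * ((r + 1 / log 2) / log t) := by
      rw [fr', abs_mul, abs_of_pos (by positivity : 0 < t ^ r / t)]
      gcongr
      refine (abs_sub _ _).trans ?_
      rw [abs_of_nonneg (by positivity), abs_of_nonneg (by positivity), add_div]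
      refine add_le_add le_rfl ?_
      rw [pow_two, ← div_div]
      gcongr
    calc |G t - fr' r t * (Chebyshev.theta t - t)| ≤ |G t| + |fr' r t * (Chebyshev.theta t - t)| := abs_sub _ _
      _ = G t + |fr' r t| * |Chebyshev.theta t - t| := by rw [hGt, abs_mul]
      _ ≤ G t + t ^ r / t * ((r + 1 / log 2) / log t) * (C1 * t / log t ^ (K + 1)) := by
        gcongr
        exact hθ t ht2
      _ = _ := by
        simp only [hG, hM]
        field_simp
        ring
  rw [intervalIntegral.integral_const_mul] at bI
  have hM0 : 0 ≤ M := by positivity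
  have bI2 := bI.trans (mul_le_mul_of_nonneg_left (hI x hx) hM0)
  have b1 : |fr r x * (Chebyshev.theta x - x)| ≤ C1 * x ^ (r + 1) / log x ^ (K + 2) := by
    rw [abs_mul, fr, abs_of_pos (by positivity)]
    calc _ ≤ x ^ r / log x * (C1 * x / log x ^ (K + 1)) := by gcongr; exact hθ x hx
      _ = _ := by field_simp; ring
  have b2 : D ≤ D * C3 * x ^ (r + 1) / log x ^ (K + 2) := by
    rw [le_div_iff₀ (by positivity), mul_assoc]
    refine mul_le_mul_of_nonneg_left ?_ (abs_nonneg _)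
    refine (hlog x (by linarith)).trans ?_
    gcongr
    have : √x ≤ x := by rw [Real.sqrt_le_left (by linarith)]; nlinarith
    refine this.trans ?_
    exact le_self_pow₀ (by linarith) (by omega)
  rw [main]
  refine (abs_add_le _ _).trans ?_
  refine (add_le_add_left (abs_add_le _ _) _).trans ?_
  have e3 : (C1 + D * C3 + M * C2) * x ^ (r + 1) / log x ^ (K + 2) = C1 * x ^ (r + 1) / log x ^ (K + 2)
    + D * C3 * x ^ (r + 1) / log x ^ (K + 2) + M * (C2 * x ^ (r + 1) / log x ^ (K + 2)) := by ring
  rw [e3]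
  linarith

end BA

namespace BA
open Filter Asymptotics

/-- `1 / log n` -/
noncomputable def yy (n : ℕ) : ℝ := 1 / log n
/-- `log log n / log n` -/
noncomputable def zz (n : ℕ) : ℝ := log (log n) / log n

lemma tendsto_logn : Tendsto (fun n : ℕ => log (n:ℝ)) atTop atTop := tendsto_log_atTop.comp tendsto_natCast_atTop_atTop
lemma tendsto_loglogn : Tendsto (fun n : ℕ => log (log (n:ℝ))) atTop atTop := tendsto_log_atTop.comp tendsto_logn

lemma tendsto_pow_loglog_div (j k : ℕ) (hk : 1 ≤ k) :
    Tendsto (fun n : ℕ => log (log (n:ℝ)) ^ j / log n ^ k) atTop (nhds 0) := by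
  have h1 : (fun x : ℝ => log x ^ j) =o[atTop] fun x : ℝ => x := isLittleO_pow_log_id_atTop
  have h2 : (fun x : ℝ => x) =O[atTop] fun x : ℝ => x ^ k := by
    refine IsBigO.of_bound 1 ?_
    filter_upwards [eventually_ge_atTop 1] with x hx
    rw [one_mul, Real.norm_of_nonneg (by linarith), Real.norm_of_nonneg (by positivity)]
    exact le_self_pow₀ hx (by omega)
  exact ((h1.trans_isBigO h2).tendsto_div_nhds_zero).comp tendsto_logn

lemma tendsto_yy : Tendsto yy atTop (nhds 0) := by
  have := tendsto_pow_loglog_div 0 1 le_rfl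
  exact this.congr fun n => by simp [yy]
lemma tendsto_zz : Tendsto zz atTop (nhds 0) := by
  have := tendsto_pow_loglog_div 1 1 le_rfl
  exact this.congr fun n => by simp [zz]

lemma ev_large : ∀ᶠ n : ℕ in atTop, 1 ≤ log (n:ℝ) ∧ 1 ≤ log (log (n:ℝ)) :=
  (tendsto_logn.eventually_ge_atTop 1).and (tendsto_loglogn.eventually_ge_atTop 1)

lemma yy_isBigO_zz : yy =O[atTop] zz := by
  refine IsBigO.of_bound 1 ?_
  filter_upwards [ev_large] with n ⟨h1, h2⟩
  have : 0 < log (n:ℝ) := by linarith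
  rw [one_mul, yy, zz, Real.norm_of_nonneg (by positivity), Real.norm_of_nonneg (by positivity)]
  gcongr

lemma zz_isBigO_one : zz =O[atTop] (1 : ℕ → ℝ) := tendsto_zz.isBigO_one ℝ

lemma zz_pow_mono {a b : ℕ} (h : a ≤ b) : (zz ^ b) =O[atTop] (zz ^ a) := by
  obtain ⟨c, rfl⟩ := Nat.exists_eq_add_of_le h
  rw [pow_add]
  have := (isBigO_refl (zz ^ a) atTop).mul (zz_isBigO_one.pow c)
  exact this.congr (fun n => by simp) (fun n => by simp)

noncomputable def PP : Subalgebra ℚ (ℕ → ℝ) := Algebra.adjoin ℚ {yy, zz}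

lemma PP_bdd (g : ℕ → ℝ) (hg : g ∈ PP) : g =O[atTop] (1 : ℕ → ℝ) := by
  refine Algebra.adjoin_induction (p := fun g _ => g =O[atTop] (1 : ℕ → ℝ)) ?_ ?_ ?_ ?_ hg
  · intro g hg
    rcases hg with rfl | rfl
    · exact yy_isBigO_zz.trans zz_isBigO_one
    · exact zz_isBigO_one
  · intro r
    exact isBigO_const_const ((algebraMap ℚ ℝ) r) one_ne_zero atTop
  · intro f g _ _ hf hg; exact hf.add hg
  · intro f g _ _ hf hg
    have := hf.mul hg
    exact this.congr (fun n => by simp) (fun n => by simp)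

/-- functions with an expansion in polynomials in `y,z` up to `O(z^M)` -/
noncomputable def AA (M : ℕ) : Subalgebra ℚ (ℕ → ℝ) where
  carrier := {f | ∃ g ∈ PP, (f - g) =O[atTop] (zz ^ M)}
  mul_mem' := by
    rintro f g ⟨P, hP, hfP⟩ ⟨Q, hQ, hgQ⟩
    refine ⟨P * Q, PP.mul_mem hP hQ, ?_⟩
    have h1 : (zz ^ M) =O[atTop] (1 : ℕ → ℝ) := by simpa using zz_pow_mono (Nat.zero_le M)
    have hg : g =O[atTop] (1 : ℕ → ℝ) := by
      have := (hgQ.trans h1).add (PP_bdd Q hQ)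
      refine this.congr_left fun n => ?_
      simp
    have e : f * g - P * Q = (f - P) * g + P * (g - Q) := by ring
    rw [e]
    refine IsBigO.add ?_ ?_
    · exact (hfP.mul hg).congr (fun n => by simp) (fun n => by simp)
    · exact ((PP_bdd P hP).mul hgQ).congr (fun n => by simp) (fun n => by simp)
  add_mem' := by
    rintro f g ⟨P, hP, hfP⟩ ⟨Q, hQ, hgQ⟩
    refine ⟨P + Q, PP.add_mem hP hQ, ?_⟩
    rw [add_sub_add_comm]
    exact hfP.add hgQ
  algebraMap_mem' := fun r => ⟨algebraMap ℚ _ r, PP.algebraMap_mem r, by rw [sub_self]; exact isBigO_zero _ _⟩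

lemma AA_of_isBigO {M : ℕ} {f : ℕ → ℝ} (h : f =O[atTop] (zz ^ M)) : f ∈ AA M :=
  ⟨0, PP.zero_mem, by simpa using h⟩

lemma AA_of_PP {M : ℕ} {f : ℕ → ℝ} (h : f ∈ PP) : f ∈ AA M :=
  ⟨f, h, by rw [sub_self]; exact isBigO_zero _ _⟩

lemma yy_mem : yy ∈ PP := Algebra.subset_adjoin (by simp)
lemma zz_mem : zz ∈ PP := Algebra.subset_adjoin (by simp)

lemma AA_congr_isBigO {M : ℕ} {f g : ℕ → ℝ} (hg : g ∈ AA M) (h : (f - g) =O[atTop] (zz ^ M)) : f ∈ AA M := by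
  have : f = (f - g) + g := by ring
  rw [this]
  exact (AA M).add_mem (AA_of_isBigO h) hg

lemma AA_congr {M : ℕ} {f g : ℕ → ℝ} (hg : g ∈ AA M) (h : f =ᶠ[atTop] g) : f ∈ AA M := by
  refine AA_congr_isBigO hg ?_
  have : (f - g) =ᶠ[atTop] 0 := by filter_upwards [h] with n hn; simp [hn]
  exact this.trans_isBigO (isBigO_zero _ _)

lemma AA_yy_mul {M : ℕ} {f : ℕ → ℝ} (hf : f ∈ AA M) : yy * f ∈ AA (M + 1) := by
  obtain ⟨g, hg, h⟩ := hf
  refine ⟨yy * g, PP.mul_mem yy_mem hg, ?_⟩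
  rw [← mul_sub, pow_succ']
  exact yy_isBigO_zz.mul h

lemma AA_const (M : ℕ) (q : ℚ) : (fun _ => (q : ℝ)) ∈ AA M := (AA M).algebraMap_mem q

lemma AA_aeval {M : ℕ} {f : ℕ → ℝ} (hf : f ∈ AA M) (p : ℚ[X]) : aeval f p ∈ AA M := by
  rw [Polynomial.aeval_eq_sum_range]
  exact (AA M).sum_mem fun i _ => (AA M).smul_mem ((AA M).pow_mem hf i) _

/-- composition with functions having rational Taylor expansions at 0. -/
lemma AA_comp {M : ℕ} {f : ℕ → ℝ} (hf : f ∈ AA M) (hz : f =O[atTop] zz) (F : ℝ → ℝ)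
    (p : ℚ[X]) (hF : (fun t => F t - aeval t p) =O[nhds 0] fun t => t ^ M) : (fun n => F (f n)) ∈ AA M := by
  have ht : Tendsto f atTop (nhds 0) := hz.trans_tendsto tendsto_zz
  refine AA_congr_isBigO (g := aeval f p) (AA_aeval hf p) ?_
  have h1 := (hF.comp_tendsto ht).trans (hz.pow M)
  refine h1.congr_left fun n => ?_
  simp only [Function.comp_def, Pi.sub_apply]
  congr 1
  have := Polynomial.aeval_algHom_apply (Pi.evalAlgHom ℚ (fun _ : ℕ => ℝ) n) f p
  simpa using this

lemma AA_inv {M : ℕ} {f : ℕ → ℝ} (hf : f ∈ AA M) (hz : f =O[atTop] zz) : (fun n => 1 / (1 + f n)) ∈ AA M := by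
  refine AA_comp hf hz (fun t => 1 / (1 + t)) (∑ k ∈ Finset.range M, (-X) ^ k) ?_
  refine IsBigO.of_bound 2 ?_
  have : Set.Ioo (-(1/2) : ℝ) (1/2) ∈ nhds (0:ℝ) := Ioo_mem_nhds (by norm_num) (by norm_num)
  filter_upwards [this] with t ht
  have hpos : 0 < 1 + t := by linarith [ht.1]
  have e : (1 / (1 + t) - aeval t (∑ k ∈ Finset.range M, (-X : ℚ[X]) ^ k)) = (-t) ^ M / (1 + t) := by
    simp only [map_sum, map_pow, map_neg, aeval_X]
    have h := geom_sum_mul_neg (-t) M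
    rw [sub_neg_eq_add] at h
    field_simp
    linarith
  rw [e, norm_div, norm_pow, norm_neg, norm_pow, Real.norm_of_nonneg hpos.le, div_le_iff₀ hpos]
  have : 0 ≤ ‖t‖ ^ M := by positivity
  nlinarith [ht.1]

lemma AA_log {M : ℕ} {f : ℕ → ℝ} (hf : f ∈ AA M) (hz : f =O[atTop] zz) : (fun n => log (1 + f n)) ∈ AA M := by
  refine AA_comp hf hz (fun t => log (1 + t))
    (- ∑ k ∈ Finset.range M, Polynomial.C (1 / ((k:ℚ) + 1)) * (-X) ^ (k + 1)) ?_
  refine IsBigO.of_bound 1 ?_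
  have : Set.Ioo (-(1/2) : ℝ) (1/2) ∈ nhds (0:ℝ) := Ioo_mem_nhds (by norm_num) (by norm_num)
  filter_upwards [this] with t ht
  have habs : |t| < 1/2 := abs_lt.mpr ⟨ht.1, ht.2⟩
  have h := Real.abs_log_sub_add_sum_range_le (x := -t) (by rw [abs_neg]; linarith) M
  rw [abs_neg, sub_neg_eq_add] at h
  have e : log (1 + t) - aeval t (- ∑ k ∈ Finset.range M, Polynomial.C (1 / ((k:ℚ) + 1)) * (-X : ℚ[X]) ^ (k + 1))
      = (∑ i ∈ Finset.range M, (-t) ^ (i + 1) / ((i:ℝ) + 1)) + log (1 + t) := by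
    simp only [map_sum, map_pow, map_neg, aeval_X, map_mul, aeval_C]
    rw [sub_neg_eq_add, add_comm]
    congr 1
    refine Finset.sum_congr rfl fun k _ => ?_
    simp; ring
  rw [e, Real.norm_eq_abs]
  refine h.trans ?_
  rw [norm_pow, Real.norm_eq_abs, one_mul, div_le_iff₀ (by linarith), pow_succ]
  have : 0 ≤ |t| ^ M := by positivity
  nlinarith

/-- extraction of the coefficients -/
lemma PP_extract (g : ℕ → ℝ) (hg : g ∈ PP) (M : ℕ) : ∃ U : ℕ → ℚ[X], (∀ i, (U i).natDegree ≤ i) ∧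
    (∀ i, (fun n : ℕ => aeval (log (log (n:ℝ))) (U i) / log n ^ i) =O[atTop] (zz ^ i)) ∧
    (fun n : ℕ => g n - ∑ i ∈ Finset.range M, aeval (log (log (n:ℝ))) (U i) / log n ^ i) =O[atTop] (zz ^ M) := by
  have hr : ({yy, zz} : Set (ℕ → ℝ)) = Set.range ![yy, zz] := by simp [Matrix.range_cons, Set.pair_comm]
  rw [PP, hr, Algebra.adjoin_range_eq_range_aeval] at hg
  obtain ⟨Q, rfl⟩ := hg
  induction Q using MvPolynomial.induction_on' with
  | monomial d a =>
    have hval : ∀ n, ((MvPolynomial.aeval ![yy, zz]) (MvPolynomial.monomial d a)) n = (a:ℝ) * (yy n ^ d 0 * zz n ^ d 1) := by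
      intro n
      rw [MvPolynomial.aeval_monomial, Finsupp.prod_fintype _ _ (by simp)]
      simp [Fin.prod_univ_two]
    have hval2 : ∀ n : ℕ, (a:ℝ) * (yy n ^ d 0 * zz n ^ d 1) = aeval (log (log (n:ℝ))) (Polynomial.C a * X ^ (d 1) : ℚ[X]) / log n ^ (d 0 + d 1) := by
      intro n
      simp only [yy, zz, map_mul, aeval_C, map_pow, aeval_X, eq_ratCast, div_pow, pow_add, one_pow]
      ring
    have key : (fun n => (a:ℝ) * (yy n ^ d 0 * zz n ^ d 1)) =O[atTop] (zz ^ (d 0 + d 1)) := by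
      have h1 := ((yy_isBigO_zz.pow (d 0)).mul (isBigO_refl (fun n => zz n ^ d 1) atTop)).const_mul_left (a:ℝ)
      exact h1.congr_right fun n => by simp [pow_add]
    refine ⟨fun i => if i = d 0 + d 1 then Polynomial.C a * X ^ (d 1) else 0, ?_, ?_, ?_⟩
    · intro i
      simp only
      split_ifs with h
      · refine (natDegree_C_mul_X_pow_le _ _).trans (by omega)
      · simp
    · intro i
      simp only
      split_ifs with h
      · have := (key).congr_left hval2
        rw [h]
        refine this.congr_left fun n => ?_
        simp
      · simpa using isBigO_zero _ _
    · by_cases hM : d 0 + d 1 < M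
      · refine (isBigO_zero _ _).congr_left fun n => ?_
        rw [Finset.sum_eq_single (d 0 + d 1)]
        · simp only [if_true]
          rw [← hval2, ← hval]; exact (sub_self _).symm
        · intro b _ hb; simp [hb]
        · intro hb; simp at hb; omega
      · refine (key.trans (zz_pow_mono (by omega : M ≤ d 0 + d 1))).congr_left fun n => ?_
        rw [Finset.sum_eq_zero, sub_zero]
        · exact (hval n).symm
        · intro i hi
          have : i ≠ d 0 + d 1 := by have := Finset.mem_range.1 hi; omega
          simp [this]
  | add p q hp hq =>
    obtain ⟨U, u1, u2, u3⟩ := hp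
    obtain ⟨V, v1, v2, v3⟩ := hq
    refine ⟨fun i => U i + V i, fun i => (natDegree_add_le _ _).trans (max_le (u1 i) (v1 i)), fun i => ?_, ?_⟩
    · refine ((u2 i).add (v2 i)).congr_left fun n => ?_
      rw [map_add]; ring
    · refine (u3.add v3).congr_left fun n => ?_
      simp only [map_add, Pi.add_apply, add_div, Finset.sum_add_distrib]
      ring

end BA

namespace BA
open Filter Asymptotics

lemma Sr_nth (r n : ℕ) : Sr r (Nat.nth Nat.Prime n) = ∑ k ∈ Finset.range (n + 1), (Nat.nth Nat.Prime k : ℝ) ^ r := by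
  unfold Sr
  rw [Nat.floor_natCast]
  symm
  refine Finset.sum_nbij (Nat.nth Nat.Prime) ?_ ?_ ?_ ?_
  · intro k hk
    have hk := Finset.mem_range.1 hk
    simp only [Finset.mem_filter, Finset.mem_Icc, Nat.zero_le, true_and]
    exact ⟨(Nat.nth_le_nth Nat.infinite_setOfPred_prime).2 (by omega), Nat.prime_nth_prime k⟩
  · exact (Nat.nth_injective Nat.infinite_setOfPred_prime).injOn
  · intro p hp
    simp only [Finset.coe_filter, Finset.mem_Icc, Nat.zero_le, true_and, Set.mem_ofPred_eq] at hp
    refine ⟨Nat.count Nat.Prime p, ?_, Nat.nth_count hp.2⟩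
    simp only [Finset.coe_range, Set.mem_Iio]
    have h := hp.1
    rw [← Nat.nth_count hp.2, Nat.nth_le_nth Nat.infinite_setOfPred_prime] at h
    omega
  · intro k _; rfl

lemma Sr_nthPrime (r n : ℕ) (hn : 1 ≤ n) : Sr r (nthPrime n) = ∑ k ∈ Finset.Icc 1 n, (nthPrime k : ℝ) ^ r := by
  obtain ⟨n, rfl⟩ := Nat.exists_eq_add_of_le' hn
  unfold nthPrime
  rw [Nat.add_sub_cancel, Sr_nth, Finset.range_eq_Ico, Finset.sum_Ico_eq_sum_range, ← Finset.Ico_add_one_right_eq_Icc, Finset.sum_Ico_eq_sum_range]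
  simp

lemma nthPrime_ge (n : ℕ) : n ≤ nthPrime n := by
  unfold nthPrime
  have := Nat.add_two_le_nth_prime (n - 1)
  omega
lemma nthPrime_two (n : ℕ) : 2 ≤ nthPrime n := by
  unfold nthPrime
  have := Nat.add_two_le_nth_prime (n - 1)
  omega

noncomputable def XX (n : ℕ) : ℝ := log (nthPrime n)
noncomputable def ww (n : ℕ) : ℝ := 1 / XX n

lemma XX_pos (n : ℕ) : 0 < XX n := log_pos (by exact_mod_cast nthPrime_two n)
lemma ww_pos (n : ℕ) : 0 < ww n := by have := XX_pos n; unfold ww; positivity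
lemma pp_pos (n : ℕ) : (0:ℝ) < nthPrime n := by have := nthPrime_two n; positivity

lemma tendsto_XX : Tendsto XX atTop atTop := by
  refine tendsto_log_atTop.comp (tendsto_natCast_atTop_atTop.comp ?_)
  exact tendsto_atTop_mono nthPrime_ge tendsto_id

lemma tendsto_ww : Tendsto ww atTop (nhds 0) := by
  have := tendsto_XX.inv_tendsto_atTop
  exact this.congr fun n => by simp [ww]

lemma expand (r K : ℕ) : (fun n => (r + 1) * XX n * Sr r (nthPrime n) / (nthPrime n : ℝ) ^ (r + 1)
    - ∑ k ∈ Finset.range (K + 1), (k.factorial : ℝ) / (r + 1) ^ k * ww n ^ k) =O[atTop] (fun n => ww n ^ (K + 1)) := by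
  obtain ⟨C, hC, h⟩ := Sr_asymp r K
  refine IsBigO.of_bound ((r + 1) * C) (Eventually.of_forall fun n => ?_)
  have h := h (nthPrime n) (by exact_mod_cast nthPrime_two n)
  have hp := pp_pos n
  have hX := XX_pos n
  have hw := ww_pos n
  rw [Real.norm_eq_abs, Real.norm_of_nonneg (by positivity)]
  have e : (r + 1) * XX n * Sr r (nthPrime n) / (nthPrime n : ℝ) ^ (r + 1)
    - ∑ k ∈ Finset.range (K + 1), (k.factorial : ℝ) / (r + 1) ^ k * ww n ^ k =
    ((r + 1) * XX n / (nthPrime n : ℝ) ^ (r + 1)) * (Sr r (nthPrime n) - Pm r (K + 1) (nthPrime n)) := by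
    unfold Pm
    rw [mul_sub]
    congr 1
    · ring
    · rw [← mul_assoc, div_mul_cancel₀ _ (by positivity), Finset.mul_sum]
      refine Finset.sum_congr rfl fun k _ => ?_
      unfold cc ww
      change _ = ((r:ℝ) + 1) * XX n * ((k.factorial : ℝ) / (r + 1) ^ (k + 1) / XX n ^ (k + 1))
      have : (r:ℝ) + 1 ≠ 0 := by positivity
      rw [one_div_pow]
      field_simp
      ring
  rw [e, abs_mul, abs_of_nonneg (by positivity)]
  refine (mul_le_mul_of_nonneg_left h (by positivity)).trans (le_of_eq ?_)
  change _ * (C * _ / XX n ^ (K + 2)) = _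
  unfold ww
  rw [one_div_pow]
  field_simp
  ring

noncomputable def A1 (n : ℕ) : ℝ := n * XX n / nthPrime n - 1
noncomputable def A1' (n : ℕ) : ℝ := 2 * XX n * (∑ k ∈ Finset.Icc 1 n, (nthPrime k : ℝ)) / (nthPrime n : ℝ) ^ 2 - 1
noncomputable def A2 (n : ℕ) : ℝ := (A1 n - ww n) / ww n ^ 2
noncomputable def D2 (n : ℕ) : ℝ := (A1 n - A1' n - ww n / 2 - 3 / 2 * ww n ^ 2) / ww n ^ 3

lemma A1_expand (K : ℕ) : (fun n => 1 + A1 n - ∑ k ∈ Finset.range (K + 1), (k.factorial : ℝ) * ww n ^ k)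
    =O[atTop] (fun n => ww n ^ (K + 1)) := by
  refine (expand 0 K).congr' ?_ EventuallyEq.rfl
  filter_upwards [eventually_ge_atTop 1] with n hn
  rw [Sr_nthPrime _ _ hn]
  simp [A1]
  ring

lemma A1'_expand (K : ℕ) : (fun n => 1 + A1' n - ∑ k ∈ Finset.range (K + 1), (k.factorial : ℝ) / 2 ^ k * ww n ^ k)
    =O[atTop] (fun n => ww n ^ (K + 1)) := by
  refine (expand 1 K).congr' ?_ EventuallyEq.rfl
  filter_upwards [eventually_ge_atTop 1] with n hn
  rw [Sr_nthPrime _ _ hn]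
  simp only [A1', pow_one, Nat.cast_one]
  norm_num

lemma div_ww {f : ℕ → ℝ} {a b : ℕ} (h : f =O[atTop] (fun n => ww n ^ (a + b))) :
    (fun n => f n / ww n ^ b) =O[atTop] (fun n => ww n ^ a) := by
  have := h.mul (isBigO_refl (fun n => (ww n ^ b)⁻¹) atTop)
  refine this.congr (fun n => by rw [div_eq_mul_inv]) fun n => ?_
  have := ww_pos n
  rw [pow_add]; field_simp

lemma A2_expand (K : ℕ) : (fun n => A2 n - ∑ k ∈ Finset.range K, (((k + 2).factorial : ℚ) : ℝ) * ww n ^ k)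
    =O[atTop] (fun n => ww n ^ K) := by
  have := div_ww (a := K) (b := 2) (A1_expand (K + 1))
  refine this.congr_left fun n => ?_
  have := ww_pos n
  rw [Finset.sum_range_succ', Finset.sum_range_succ', A2, eq_comm, eq_div_iff (by positivity), sub_mul, div_mul_cancel₀ _ (by positivity), Finset.sum_mul]
  have : ∀ k ∈ Finset.range K, (((k + 2).factorial : ℚ) : ℝ) * ww n ^ k * ww n ^ 2 = ((k + 1 + 1).factorial : ℝ) * ww n ^ (k + 1 + 1) := by
    intro k _; push_cast; ring
  rw [Finset.sum_congr rfl this]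
  simp
  ring

lemma D2_expand (K : ℕ) : (fun n => D2 n - ∑ k ∈ Finset.range K, (((k + 3).factorial * (1 - 1 / 2 ^ (k + 3)) : ℚ) : ℝ) * ww n ^ k)
    =O[atTop] (fun n => ww n ^ K) := by
  have := div_ww (a := K) (b := 3) ((A1_expand (K + 2)).sub (A1'_expand (K + 2)))
  refine this.congr_left fun n => ?_
  have := ww_pos n
  rw [Finset.sum_range_succ', Finset.sum_range_succ', Finset.sum_range_succ', Finset.sum_range_succ', Finset.sum_range_succ', Finset.sum_range_succ', D2, eq_comm, eq_div_iff (by positivity), sub_mul, div_mul_cancel₀ _ (by positivity), Finset.sum_mul]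
  have : ∀ k ∈ Finset.range K, (((k + 3).factorial * (1 - 1 / 2 ^ (k + 3)) : ℚ) : ℝ) * ww n ^ k * ww n ^ 3
      = ((k + 1 + 1 + 1).factorial : ℝ) * ww n ^ (k + 1 + 1 + 1) - ((k + 1 + 1 + 1).factorial : ℝ) / 2 ^ (k + 1 + 1 + 1) * ww n ^ (k + 1 + 1 + 1) := by
    intro k _; push_cast; ring
  rw [Finset.sum_congr rfl this, Finset.sum_sub_distrib]
  norm_num [Nat.factorial]
  ring

lemma tendsto_A2 : Tendsto A2 atTop (nhds 2) := by
  have h := (A2_expand 1).trans_tendsto (by simpa using tendsto_ww)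
  have := h.add_const 2
  simp only [zero_add] at this
  refine this.congr fun n => ?_
  norm_num [Nat.factorial]

lemma tendsto_D2 : Tendsto D2 atTop (nhds (21/4)) := by
  have h := (D2_expand 1).trans_tendsto (by simpa using tendsto_ww)
  have := h.add_const (21/4)
  simp only [zero_add] at this
  refine this.congr fun n => ?_
  norm_num [Nat.factorial]

lemma A1_eq (n : ℕ) : A1 n = ww n + ww n ^ 2 * A2 n := by
  have := ww_pos n
  unfold A2; field_simp; ring

lemma tendsto_A1 : Tendsto A1 atTop (nhds 0) := by
  have := tendsto_ww.add ((tendsto_ww.pow 2).mul tendsto_A2)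
  simp only [ne_eq, OfNat.ofNat_ne_zero, not_false_eq_true, zero_pow, zero_mul, add_zero] at this
  exact this.congr fun n => (A1_eq n).symm

lemma one_add_A1 (n : ℕ) : 1 + A1 n = n * XX n / nthPrime n := by unfold A1; ring

/-- second-order coefficient function of `B n / n ^ 2` in `w` -/
noncomputable def c2 (n : ℕ) : ℝ :=
  (2 * D2 n - 3 - ww n - 2 * A2 n * (1 + ww n) ^ 2 - ww n ^ 2 * A2 n ^ 2 * (1 + ww n)) / 4 * (1 / (1 + A1 n)) ^ 2

lemma B_eq (n : ℕ) (hn : 1 ≤ n) : B n / (n:ℝ) ^ 2 = 1 / 4 + ww n / 4 + ww n ^ 2 * c2 n := by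
  have hp := pp_pos n
  have hX := XX_pos n
  have hw := ww_pos n
  have hn' : (0:ℝ) < n := by exact_mod_cast hn
  have hA : 0 < 1 + A1 n := by rw [one_add_A1]; positivity
  have hXw : XX n = 1 / ww n := by unfold ww; field_simp
  have e1 : (n:ℝ) = (1 + A1 n) * nthPrime n * ww n := by
    rw [one_add_A1, hXw]; field_simp
  have e2 : (∑ k ∈ Finset.Icc 1 n, (nthPrime k : ℝ)) = (1 + A1' n) * (nthPrime n : ℝ) ^ 2 * ww n / 2 := by
    unfold A1'; rw [hXw]; field_simp; ring
  have e3 : A1' n = A1 n - ww n / 2 - 3 / 2 * ww n ^ 2 - ww n ^ 3 * D2 n := by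
    unfold D2; field_simp; ring
  have e4 := A1_eq n
  unfold B c2
  rw [e2, e3]
  have : (n:ℝ) * (nthPrime n) / 2 = (1 + A1 n) * nthPrime n * ww n * nthPrime n / 2 := by rw [← e1]
  rw [this, e1]
  rw [div_eq_iff (by positivity)]
  have h5 : (1 / (1 + A1 n)) ^ 2 * ((1 + A1 n) * (nthPrime n) * ww n) ^ 2 = (nthPrime n * ww n) ^ 2 := by
    field_simp
  have h6 : (1 / 4 + ww n / 4 + ww n ^ 2 * ((2 * D2 n - 3 - ww n - 2 * A2 n * (1 + ww n) ^ 2 - ww n ^ 2 * A2 n ^ 2 * (1 + ww n)) / 4 * (1 / (1 + A1 n)) ^ 2)) * ((1 + A1 n) * (nthPrime n) * ww n) ^ 2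
     = (1 / 4 + ww n / 4) * ((1 + A1 n) * (nthPrime n) * ww n) ^ 2 + ww n ^ 2 * ((2 * D2 n - 3 - ww n - 2 * A2 n * (1 + ww n) ^ 2 - ww n ^ 2 * A2 n ^ 2 * (1 + ww n)) / 4) * ((1 / (1 + A1 n)) ^ 2 * ((1 + A1 n) * (nthPrime n) * ww n) ^ 2) := by ring
  rw [h6, h5, e4]
  ring

end BA

namespace BA
open Filter Asymptotics

noncomputable def vv (n : ℕ) : ℝ := XX n / log n - 1
noncomputable def ee (n : ℕ) : ℝ := log (1 + vv n) - log (1 + A1 n)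

lemma logn_eq (n : ℕ) (hn : 1 ≤ n) : log (n:ℝ) = XX n - log (XX n) + log (1 + A1 n) := by
  have hp := pp_pos n
  have hX := XX_pos n
  have hn' : (0:ℝ) < n := by exact_mod_cast hn
  rw [one_add_A1, log_div (by positivity) (by positivity), log_mul (by positivity) (by positivity)]
  unfold XX
  ring

lemma tendsto_vv : Tendsto vv atTop (nhds 0) := by
  have h1 : Tendsto (fun n => log (XX n) * ww n) atTop (nhds 0) := by
    have : Tendsto (fun x : ℝ => log x * (1 / x)) atTop (nhds 0) := by
      have := (isLittleO_log_id_atTop).tendsto_div_nhds_zero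
      exact this.congr fun x => by simp [div_eq_mul_inv]
    exact this.comp tendsto_XX
  have h2 : Tendsto (fun n => log (1 + A1 n)) atTop (nhds 0) := by
    have : Tendsto (fun n => 1 + A1 n) atTop (nhds 1) := by simpa using tendsto_A1.const_add 1
    have := this.log one_ne_zero
    simpa using this
  have h3 : Tendsto (fun n => 1 - log (XX n) * ww n + log (1 + A1 n) * ww n) atTop (nhds 1) := by
    have := (h1.const_sub 1).add (h2.mul tendsto_ww)
    simpa using this
  have h4 := (h3.inv₀ one_ne_zero).sub_const 1
  simp only [inv_one, sub_self] at h4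
  refine h4.congr' ?_
  filter_upwards [eventually_ge_atTop 1] with n hn
  have hX := XX_pos n
  have : 1 - log (XX n) * ww n + log (1 + A1 n) * ww n = log n / XX n := by
    rw [logn_eq n hn]; unfold ww; field_simp
  rw [this, inv_div, vv]

lemma tendsto_log1 {f : ℕ → ℝ} (h : Tendsto f atTop (nhds 0)) : Tendsto (fun n => log (1 + f n)) atTop (nhds 0) := by
  have : Tendsto (fun n => 1 + f n) atTop (nhds 1) := by simpa using h.const_add 1
  have := this.log one_ne_zero
  simpa using this

lemma tendsto_inv1 {f : ℕ → ℝ} (h : Tendsto f atTop (nhds 0)) : Tendsto (fun n => 1 / (1 + f n)) atTop (nhds 1) := by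
  have : Tendsto (fun n => 1 + f n) atTop (nhds 1) := by simpa using h.const_add 1
  have := this.inv₀ one_ne_zero
  simpa using this

lemma tendsto_ee : Tendsto ee atTop (nhds 0) := by
  have := (tendsto_log1 tendsto_vv).sub (tendsto_log1 tendsto_A1)
  rw [sub_self] at this
  exact this

lemma vv_eq : vv =ᶠ[atTop] zz + yy * ee := by
  filter_upwards [ev_large, eventually_ge_atTop 1] with n ⟨h1, h2⟩ hn
  have hX := XX_pos n
  have hL : 0 < log (n:ℝ) := by linarith
  have e : 1 + vv n = XX n / log n := by unfold vv; ring
  have := logn_eq n hn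
  simp only [Pi.add_apply, Pi.mul_apply, ee]
  rw [e, log_div (by positivity) (by positivity)]
  unfold vv yy zz
  field_simp
  linarith

lemma bdd_mul {f g h : ℕ → ℝ} (hf : f =O[atTop] h) {a : ℝ} (hg : Tendsto g atTop (nhds a)) : (fun n => f n * g n) =O[atTop] h := by
  have := hf.mul (hg.isBigO_one ℝ)
  exact this.congr_right fun n => by simp

lemma vv_isBigO : vv =O[atTop] zz := by
  refine vv_eq.trans_isBigO ?_
  exact (isBigO_refl zz atTop).add (bdd_mul yy_isBigO_zz tendsto_ee)

lemma ww_eq : ww =ᶠ[atTop] fun n => yy n * (1 / (1 + vv n)) := by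
  filter_upwards [ev_large] with n ⟨h1, h2⟩
  have hX := XX_pos n
  have hL : 0 < log (n:ℝ) := by linarith
  have e : 1 + vv n = XX n / log n := by unfold vv; ring
  rw [e]
  unfold ww yy
  field_simp

lemma ww_isBigO : ww =O[atTop] zz := ww_eq.trans_isBigO (bdd_mul yy_isBigO_zz (tendsto_inv1 tendsto_vv))

lemma A1_isBigO : A1 =O[atTop] zz := by
  have h : Tendsto (fun n => 1 + ww n * A2 n) atTop (nhds (1 + 0 * 2)) := (tendsto_ww.mul tendsto_A2).const_add 1
  refine (bdd_mul ww_isBigO h).congr_left fun n => ?_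
  rw [A1_eq]; ring

lemma AA_series {M : ℕ} (hw : ww ∈ AA M) {f : ℕ → ℝ} (q : ℕ → ℚ)
    (h : (fun n => f n - ∑ k ∈ Finset.range M, ((q k : ℚ) : ℝ) * ww n ^ k) =O[atTop] fun n => ww n ^ M) : f ∈ AA M := by
  refine AA_congr_isBigO (g := ∑ k ∈ Finset.range M, (q k) • ww ^ k)
    ((AA M).sum_mem fun i _ => (AA M).smul_mem ((AA M).pow_mem hw i) _) ?_
  refine (h.trans (ww_isBigO.pow M)).congr_left fun n => ?_
  simp [Finset.sum_apply, Rat.smul_def]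

lemma ww_AA {M : ℕ} (hv : vv ∈ AA M) : ww ∈ AA M :=
  AA_congr ((AA M).mul_mem (AA_of_PP yy_mem) (AA_inv hv vv_isBigO)) ww_eq

lemma A2_AA {M : ℕ} (hv : vv ∈ AA M) : A2 ∈ AA M := AA_series (ww_AA hv) _ (A2_expand M)
lemma D2_AA {M : ℕ} (hv : vv ∈ AA M) : D2 ∈ AA M := AA_series (ww_AA hv) _ (D2_expand M)
lemma A1_AA {M : ℕ} (hv : vv ∈ AA M) : A1 ∈ AA M := by
  have : A1 = ww + ww ^ 2 * A2 := by funext n; simpa using A1_eq n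
  rw [this]
  exact (AA M).add_mem (ww_AA hv) ((AA M).mul_mem ((AA M).pow_mem (ww_AA hv) 2) (A2_AA hv))
lemma ee_AA {M : ℕ} (hv : vv ∈ AA M) : ee ∈ AA M :=
  (AA M).sub_mem (AA_log hv vv_isBigO) (AA_log (A1_AA hv) A1_isBigO)

lemma vv_AA (M : ℕ) : vv ∈ AA M := by
  induction M with
  | zero =>
    refine AA_of_isBigO ?_
    rw [pow_zero]
    exact vv_isBigO.trans zz_isBigO_one
  | succ M ih =>
    exact AA_congr ((AA (M + 1)).add_mem (AA_of_PP zz_mem) (AA_yy_mul (ee_AA ih))) vv_eq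

lemma c2_AA (M : ℕ) : c2 ∈ AA M := by
  have hv := vv_AA M
  have hw := ww_AA hv
  have hA := A2_AA hv
  have hD := D2_AA hv
  have hi := AA_inv (A1_AA hv) A1_isBigO
  have h1 : (1 : ℕ → ℝ) ∈ AA M := (AA M).one_mem
  have : c2 = (4⁻¹ : ℚ) • ((2:ℚ) • D2 - (3:ℚ) • 1 - ww - (2:ℚ) • A2 * (1 + ww) ^ 2 - ww ^ 2 * A2 ^ 2 * (1 + ww)) * (fun n => 1 / (1 + A1 n)) ^ 2 := by
    funext n
    simp only [c2, Rat.smul_def, Pi.smul_apply, Pi.mul_apply, Pi.sub_apply, Pi.add_apply, Pi.pow_apply, Pi.one_apply]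
    push_cast
    ring
  rw [this]
  have h1w := (AA M).add_mem h1 hw
  refine (AA M).mul_mem ((AA M).smul_mem ?_ _) ((AA M).pow_mem hi 2)
  refine (AA M).sub_mem ((AA M).sub_mem ((AA M).sub_mem ((AA M).sub_mem ((AA M).smul_mem hD _) ((AA M).smul_mem h1 _)) hw) ?_) ?_
  · exact (AA M).mul_mem ((AA M).smul_mem hA _) ((AA M).pow_mem h1w 2)
  · exact (AA M).mul_mem ((AA M).mul_mem ((AA M).pow_mem hw 2) ((AA M).pow_mem hA 2)) h1w

lemma tendsto_c2 : Tendsto c2 atTop (nhds (7/8)) := by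
  have hw := tendsto_ww
  have h1w : Tendsto (fun n => 1 + ww n) atTop (nhds (1 + 0)) := hw.const_add 1
  have := ((((((tendsto_D2.const_mul 2).sub_const 3).sub hw).sub ((tendsto_A2.const_mul 2).mul (h1w.pow 2))).sub
    (((hw.pow 2).mul (tendsto_A2.pow 2)).mul h1w)).div_const 4).mul ((tendsto_inv1 tendsto_A1).pow 2)
  norm_num at this
  refine (this.congr fun n => ?_)
  simp [c2]

noncomputable def f2 (n : ℕ) : ℝ :=
  c2 n * (1 / (1 + vv n)) ^ 2 - 1 / 4 * (ee n * (1 / (1 + vv n)) * (1 / (1 + zz n)))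

lemma f2_AA (M : ℕ) : f2 ∈ AA M := by
  have hv := vv_AA M
  have hi := AA_inv hv vv_isBigO
  have hz := AA_inv (M := M) (AA_of_PP zz_mem) (isBigO_refl zz atTop)
  have : f2 = c2 * (fun n => 1 / (1 + vv n)) ^ 2 - (1/4 : ℚ) • (ee * (fun n => 1 / (1 + vv n)) * (fun n => 1 / (1 + zz n))) := by
    funext n
    simp [f2, Rat.smul_def]
  rw [this]
  exact (AA M).sub_mem ((AA M).mul_mem (c2_AA M) ((AA M).pow_mem hi 2))
    ((AA M).smul_mem ((AA M).mul_mem ((AA M).mul_mem (ee_AA hv) hi) hz) _)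

lemma tendsto_f2 : Tendsto f2 atTop (nhds (7/8)) := by
  have h1 := tendsto_inv1 tendsto_vv
  have h2 := tendsto_inv1 tendsto_zz
  have := (tendsto_c2.mul (h1.pow 2)).sub (((tendsto_ee.mul h1).mul h2).const_mul (1/4))
  simp only [one_pow, mul_one, zero_mul, mul_zero, sub_zero] at this
  exact this

lemma B_eq2 : ∀ᶠ n : ℕ in atTop, B n / (n:ℝ) ^ 2 = 1 / 4 + yy n / 4 * (1 / (1 + zz n)) + yy n ^ 2 * f2 n := by
  filter_upwards [ww_eq, vv_eq, eventually_ge_atTop 1, tendsto_zz.eventually (lt_mem_nhds (show (-1:ℝ) < 0 by norm_num)), tendsto_vv.eventually (lt_mem_nhds (show (-1:ℝ) < 0 by norm_num))] with n hw hv hn hz hv'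
  rw [B_eq n hn, hw]
  simp only [Pi.add_apply, Pi.mul_apply] at hv
  have h1 : 0 < 1 + zz n := by linarith
  have h2 : 0 < 1 + vv n := by linarith
  unfold f2
  have key : yy n * (1 / (1 + vv n)) = yy n * (1 / (1 + zz n)) - yy n ^ 2 * (ee n * (1 / (1 + vv n)) * (1 / (1 + zz n))) := by
    have : yy n * ee n = vv n - zz n := by linarith
    have h : yy n ^ 2 * (ee n * (1 / (1 + vv n)) * (1 / (1 + zz n))) = yy n * (vv n - zz n) * (1 / (1 + vv n)) * (1 / (1 + zz n)) := by
      rw [← this]; ring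
    rw [h]
    field_simp
    ring
  linear_combination (1/4) * key

end BA

namespace BA
open Filter Asymptotics

lemma tendsto_poly_div (W : ℚ[X]) (j : ℕ) (hj : 1 ≤ j) :
    Tendsto (fun n : ℕ => aeval (log (log (n:ℝ))) W / log n ^ j) atTop (nhds 0) := by
  have : Tendsto (fun n : ℕ => ∑ i ∈ Finset.range (W.natDegree + 1), (W.coeff i : ℝ) * (log (log (n:ℝ)) ^ i / log n ^ j)) atTop
      (nhds (∑ i ∈ Finset.range (W.natDegree + 1), (W.coeff i : ℝ) * 0)) :=
    tendsto_finsetSum _ fun i _ => (tendsto_pow_loglog_div i j hj).const_mul _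
  simp only [mul_zero, Finset.sum_const_zero] at this
  refine this.congr fun n => ?_
  rw [Polynomial.aeval_eq_sum_range, Finset.sum_div]
  refine Finset.sum_congr rfl fun i _ => ?_
  rw [Rat.smul_def]; ring

lemma poly_zero (W : ℚ[X]) (h : Tendsto (fun n : ℕ => aeval (log (log (n:ℝ))) W) atTop (nhds 0)) : W = 0 := by
  by_cases hd : 0 < W.degree
  · exfalso
    have h1 : 0 < (W.map (algebraMap ℚ ℝ)).degree := by rwa [degree_map]
    have h2 := (Polynomial.abs_tendsto_atTop _ h1).comp tendsto_loglogn
    have h3 := h.abs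
    refine not_tendsto_nhds_of_tendsto_atTop h2 _ (h3.congr fun n => ?_)
    simp [Function.comp_def, eval_map_algebraMap]
  · rw [not_lt] at hd
    have e := Polynomial.eq_C_of_degree_le_zero hd
    rw [e] at h ⊢
    simp only [aeval_C] at h
    have := tendsto_nhds_unique h tendsto_const_nhds
    have h0 : W.coeff 0 = 0 := by simpa using this.symm
    simp [h0]

lemma uniq_aux (m : ℕ) (W : ℕ → ℚ[X])
    (h : (fun n : ℕ => ∑ s ∈ Finset.Icc 2 m, aeval (log (log (n:ℝ))) (W s) / log n ^ s) =O[atTop] (zz ^ (m + 1))) :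
    ∀ s ∈ Finset.Icc 2 m, W s = 0 := by
  intro s
  induction s using Nat.strong_induction_on with
  | _ s ih =>
  intro hs
  have hs' := Finset.mem_Icc.1 hs
  apply poly_zero
  have h1 : Tendsto (fun n : ℕ => log n ^ s * zz n ^ (m + 1)) atTop (nhds 0) := by
    refine (tendsto_pow_loglog_div (m + 1) (m + 1 - s) (by omega)).congr' ?_
    filter_upwards [ev_large] with n ⟨h1, h2⟩
    have hL : 0 < log (n:ℝ) := by linarith
    unfold zz
    have : m + 1 = s + (m + 1 - s) := by omega
    rw [div_pow, this, pow_add (log (n:ℝ)), ← this]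
    field_simp
  have h2 : Tendsto (fun n : ℕ => log n ^ s * ∑ s ∈ Finset.Icc 2 m, aeval (log (log (n:ℝ))) (W s) / log n ^ s) atTop (nhds 0) :=
    ((isBigO_refl (fun n : ℕ => log (n:ℝ) ^ s) atTop).mul h).trans_tendsto h1
  have h3 : Tendsto (fun n : ℕ => ∑ t ∈ (Finset.Icc 2 m).filter (fun t => s < t), aeval (log (log (n:ℝ))) (W t) / log n ^ (t - s)) atTop (nhds 0) := by
    have := tendsto_finsetSum ((Finset.Icc 2 m).filter (fun t => s < t)) (fun t ht => tendsto_poly_div (W t) (t - s) (by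
      have := (Finset.mem_filter.1 ht).2; omega))
    simpa using this
  have h4 := h2.sub h3
  rw [sub_zero] at h4
  refine h4.congr' ?_
  filter_upwards [ev_large] with n ⟨h1, _⟩
  have hL : 0 < log (n:ℝ) := by linarith
  rw [Finset.mul_sum, Finset.sum_filter, ← Finset.sum_sub_distrib, Finset.sum_eq_single s]
  · simp; field_simp
  · intro t ht hts
    rcases lt_or_gt_of_ne hts with hlt | hgt
    · rw [ih t hlt ht]; simp
    · rw [if_pos hgt]
      obtain ⟨d, rfl⟩ := Nat.exists_eq_add_of_lt hgt
      have : s + d + 1 - s = d + 1 := by omega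
      rw [this, add_assoc, pow_add]
      field_simp
      simp
  · intro h; exact absurd hs h

/-- the remainder in the expansion, normalized -/
lemma family_isBigO (m : ℕ) (V : ℕ → ℚ[X]) (h : IsBFamily m V) :
    (fun n : ℕ => B n / (n:ℝ) ^ 2 - (1 / 4 + 1 / (4 * log n) + 1 / 2 * ∑ s ∈ Finset.Icc 2 m, (-1 : ℝ) ^ (s + 1) *
       (aeval (log (log (n:ℝ))) (V s)) / ((s : ℝ) * log n ^ s))) =O[atTop] (zz ^ (m + 1)) := by
  obtain ⟨_, C, hC, N, h⟩ := h
  refine IsBigO.of_bound C ?_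
  filter_upwards [ev_large, eventually_ge_atTop N, eventually_ge_atTop 1] with n ⟨h1, h2⟩ hN hn
  have hn' : (0:ℝ) < n := by exact_mod_cast hn
  have h := h n hN
  set S := ∑ s ∈ Finset.Icc 2 m, (-1 : ℝ) ^ (s + 1) * (aeval (log (log (n:ℝ))) (V s)) / ((s : ℝ) * log n ^ s) with hS
  have e : B n / (n:ℝ) ^ 2 - (1 / 4 + 1 / (4 * log n) + 1 / 2 * S) =
    (B n - ((n : ℝ) ^ 2 / 4 + (n : ℝ) ^ 2 / (4 * Real.log n) + (n : ℝ) ^ 2 / 2 * S)) / (n:ℝ) ^ 2 := by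
    field_simp
  have hz : 0 ≤ zz n := by unfold zz; positivity
  rw [e, Real.norm_eq_abs, abs_div, abs_of_nonneg (by positivity : (0:ℝ) ≤ (n:ℝ)^2), div_le_iff₀ (by positivity)]
  refine h.trans (le_of_eq ?_)
  rw [Pi.pow_apply, Real.norm_of_nonneg (by positivity)]
  unfold zz
  rw [div_pow]; ring

lemma isBFamily_of (m : ℕ) (V : ℕ → ℚ[X]) (hdeg : ∀ s ∈ Finset.Icc 2 m, (V s).natDegree = s - 1 ∧ 0 < (V s).leadingCoeff)
    (h : (fun n : ℕ => B n / (n:ℝ) ^ 2 - (1 / 4 + 1 / (4 * log n) + 1 / 2 * ∑ s ∈ Finset.Icc 2 m, (-1 : ℝ) ^ (s + 1) *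
       (aeval (log (log (n:ℝ))) (V s)) / ((s : ℝ) * log n ^ s))) =O[atTop] (zz ^ (m + 1))) : IsBFamily m V := by
  refine ⟨hdeg, ?_⟩
  obtain ⟨C, hC, h⟩ := h.exists_pos
  refine ⟨C, hC, ?_⟩
  have := h.bound.and (ev_large.and (eventually_ge_atTop 1))
  obtain ⟨N, hN⟩ := eventually_atTop.1 this
  refine ⟨N, fun n hn => ?_⟩
  obtain ⟨h, ⟨h1, h2⟩, hn⟩ := hN n hn
  have hn' : (0:ℝ) < n := by exact_mod_cast hn
  set S := ∑ s ∈ Finset.Icc 2 m, (-1 : ℝ) ^ (s + 1) * (aeval (log (log (n:ℝ))) (V s)) / ((s : ℝ) * log n ^ s) with hS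
  have e : B n / (n:ℝ) ^ 2 - (1 / 4 + 1 / (4 * log n) + 1 / 2 * S) =
    (B n - ((n : ℝ) ^ 2 / 4 + (n : ℝ) ^ 2 / (4 * Real.log n) + (n : ℝ) ^ 2 / 2 * S)) / (n:ℝ) ^ 2 := by
    field_simp
  have hz : 0 ≤ zz n := by unfold zz; positivity
  rw [e, Real.norm_eq_abs, abs_div, abs_of_nonneg (by positivity : (0:ℝ) ≤ (n:ℝ)^2), div_le_iff₀ (by positivity)] at h
  refine h.trans (le_of_eq ?_)
  rw [Pi.pow_apply, Real.norm_of_nonneg (by positivity)]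
  unfold zz
  rw [div_pow]; ring

lemma family_unique (m : ℕ) (V V' : ℕ → ℚ[X]) (h : IsBFamily m V) (h' : IsBFamily m V') :
    ∀ s ∈ Finset.Icc 2 m, V' s = V s := by
  have key := uniq_aux m (fun s => Polynomial.C ((-1) ^ (s + 1) / (s:ℚ)) * (V' s - V s)) (by
    have := ((family_isBigO m V h).sub (family_isBigO m V' h')).const_mul_left 2
    refine this.congr_left fun n => ?_
    have e : ∀ s ∈ Finset.Icc 2 m, aeval (log (log (n:ℝ))) (Polynomial.C ((-1) ^ (s + 1) / (s:ℚ)) * (V' s - V s)) / log n ^ s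
      = (-1 : ℝ) ^ (s + 1) * (aeval (log (log (n:ℝ))) (V' s)) / ((s : ℝ) * log n ^ s) -
        (-1 : ℝ) ^ (s + 1) * (aeval (log (log (n:ℝ))) (V s)) / ((s : ℝ) * log n ^ s) := by
      intro s _
      simp only [map_mul, aeval_C, map_sub, eq_ratCast]
      push_cast
      rw [div_mul_eq_mul_div, div_div]; ring
    rw [Finset.sum_congr rfl e, Finset.sum_sub_distrib]
    ring)
  intro s hs
  have := key s hs
  have hs' := Finset.mem_Icc.1 hs
  have hs0 : (s:ℚ) ≠ 0 := by exact_mod_cast (by omega : s ≠ 0)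
  rw [mul_eq_zero, Polynomial.C_eq_zero] at this
  rcases this with h | h
  · exact absurd h (div_ne_zero (by simp) hs0)
  · exact sub_eq_zero.1 h

lemma family_exists (k : ℕ) : ∃ V : ℕ → ℚ[X], IsBFamily (k + 2) V ∧ V 2 = X - C (7 / 2) := by
  obtain ⟨g, hg, hfg⟩ := f2_AA (k + 1)
  obtain ⟨U, hU1, hU2, hU3⟩ := PP_extract g hg (k + 1)
  have hf : (fun n : ℕ => f2 n - ∑ i ∈ Finset.range (k + 1), aeval (log (log (n:ℝ))) (U i) / log n ^ i) =O[atTop] (zz ^ (k + 1)) := by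
    refine (hfg.add hU3).congr_left fun n => ?_
    simp
  have hU0 : U 0 = Polynomial.C (7/8) := by
    have e0 := Polynomial.eq_C_of_natDegree_le_zero (hU1 0)
    have t1 : Tendsto (fun n : ℕ => f2 n - ∑ i ∈ Finset.range (k + 1), aeval (log (log (n:ℝ))) (U i) / log n ^ i) atTop (nhds 0) := by
      refine hf.trans_tendsto ?_
      have := tendsto_zz.pow (k + 1)
      rw [zero_pow (by omega)] at this
      exact this
    have t2 : Tendsto (fun n : ℕ => ∑ i ∈ Finset.range k, aeval (log (log (n:ℝ))) (U (i + 1)) / log n ^ (i + 1)) atTop (nhds 0) := by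
      have := tendsto_finsetSum (Finset.range k) (fun i _ => tendsto_poly_div (U (i + 1)) (i + 1) (by omega))
      simpa using this
    have t3 := (tendsto_f2.sub t1).sub t2
    have t4 : Tendsto (fun _ : ℕ => (((U 0).coeff 0 : ℚ) : ℝ)) atTop (nhds (7/8 - 0 - 0)) := by
      refine t3.congr fun n => ?_
      rw [Finset.sum_range_succ']
      have : aeval (log (log (n:ℝ))) (U 0) = (((U 0).coeff 0 : ℚ) : ℝ) := by
        conv_lhs => rw [e0]
        simp
      rw [this]; simp
    have := tendsto_nhds_unique t4 tendsto_const_nhds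
    have h5 : (U 0).coeff 0 = 7/8 := by
      have h6 : (((U 0).coeff 0 : ℚ) : ℝ) = ((7/8 : ℚ) : ℝ) := by push_cast; linarith
      exact_mod_cast h6
    rw [e0, h5]
  refine ⟨fun s => Polynomial.C ((s:ℚ) / 2) * X ^ (s - 1) + Polynomial.C (2 * (s:ℚ) * (-1) ^ (s + 1)) * U (s - 2), ?_, ?_⟩
  · refine isBFamily_of _ _ ?_ ?_
    · intro s hs
      have hs' := Finset.mem_Icc.1 hs
      have hs0 : (0:ℚ) < (s:ℚ) / 2 := by have : 0 < s := by omega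
                                         positivity
      have hd : (Polynomial.C ((s:ℚ) / 2) * X ^ (s - 1)).natDegree = s - 1 := natDegree_C_mul_X_pow _ _ hs0.ne'
      have hlt : (Polynomial.C (2 * (s:ℚ) * (-1) ^ (s + 1)) * U (s - 2)).natDegree < (Polynomial.C ((s:ℚ) / 2) * X ^ (s - 1)).natDegree := by
        rw [hd]
        refine (natDegree_C_mul_le _ _).trans_lt ((hU1 _).trans_lt (by omega))
      refine ⟨by rw [natDegree_add_eq_left_of_natDegree_lt hlt, hd], ?_⟩
      rw [leadingCoeff_add_of_degree_lt' (degree_lt_degree hlt), leadingCoeff_C_mul_X_pow]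
      exact hs0
    · have hb1 : (fun n => yy n / 4 * ((-zz n) ^ (k + 2) * (1 / (1 + zz n)))) =O[atTop] (zz ^ (k + 2 + 1)) := by
        have h1 := bdd_mul ((yy_isBigO_zz.mul ((isBigO_refl zz atTop).neg_left.pow (k + 2)))) (tendsto_inv1 tendsto_zz)
        refine (h1.const_mul_left (1/4)).congr (fun n => ?_) (fun n => ?_)
        · ring
        · simp [pow_succ]; ring
      have hb2 : (fun n => yy n ^ 2 * (f2 n - ∑ i ∈ Finset.range (k + 1), (aeval (log (log (n:ℝ)))) (U i) / log n ^ i)) =O[atTop]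
          (zz ^ (k + 2 + 1)) := by
        refine ((yy_isBigO_zz.pow 2).mul hf).congr_right fun n => ?_
        simp only [Pi.pow_apply]; ring
      refine (hb1.add hb2).congr' ?_ EventuallyEq.rfl
      · filter_upwards [ev_large, B_eq2, tendsto_zz.eventually (lt_mem_nhds (show (-1:ℝ) < 0 by norm_num))] with n ⟨h1, h2⟩ hB hz
        have hz1 : 0 < 1 + zz n := by linarith
        have hL : 0 < log (n:ℝ) := by linarith
        rw [hB, ← Finset.Ico_add_one_right_eq_Icc, Finset.sum_Ico_eq_sum_range]
        have hidx : k + 2 + 1 - 2 = k + 1 := by omega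
        rw [hidx]
        have hterm : ∀ i ∈ Finset.range (k + 1), (-1 : ℝ) ^ (2 + i + 1) *
            (aeval (log (log (n:ℝ))) (Polynomial.C (((2 + i : ℕ):ℚ) / 2) * X ^ (2 + i - 1) + Polynomial.C (2 * ((2 + i : ℕ):ℚ) * (-1) ^ (2 + i + 1)) * U (2 + i - 2)))
             / (((2 + i : ℕ) : ℝ) * log n ^ (2 + i)) =
            yy n / 2 * (-zz n) ^ (i + 1) + 2 * yy n ^ 2 * (aeval (log (log (n:ℝ))) (U i) / log n ^ i) := by
          intro i _
          have i1 : 2 + i - 1 = i + 1 := by omega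
          have i2 : 2 + i - 2 = i := by omega
          rw [i1, i2]
          simp only [map_add, map_mul, aeval_C, map_pow, aeval_X, eq_ratCast]
          have hi : ((2 + i : ℕ) : ℝ) ≠ 0 := by positivity
          have hsq : ((-1:ℝ) ^ (2 + i + 1)) * ((-1:ℝ) ^ (2 + i + 1)) = 1 := by
            rw [← mul_pow]; simp
          have hneg : (-1:ℝ) ^ (2 + i + 1) = (-1) ^ (i + 1) := by rw [add_assoc, pow_add]; simp
          have hz2 : (-zz n) ^ (i + 1) = (-1) ^ (i + 1) * zz n ^ (i + 1) := by rw [← mul_pow]; simp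
          rw [hz2, ← hneg]
          generalize (aeval (log (log (n:ℝ)))) (U i) = u
          push_cast at hi ⊢
          generalize hε : (-1:ℝ) ^ (2 + i + 1) = ε at *
          unfold yy zz
          rw [mul_add, add_div]
          congr 1
          · rw [div_pow, pow_add (log (n:ℝ)) 2 i, pow_succ (log (n:ℝ)) i]
            field_simp
          · have : ε * (2 * (2 + (i:ℝ)) * ε * u) = 2 * (2 + (i:ℝ)) * u * (ε * ε) := by ring
            rw [this, hsq, pow_add]
            field_simp
        have hsum := Finset.sum_congr rfl hterm
        rw [hsum, Finset.sum_add_distrib, ← Finset.mul_sum, ← Finset.mul_sum]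
        have hgeom : 1 / (1 + zz n) = 1 + ∑ i ∈ Finset.range (k + 1), (-zz n) ^ (i + 1) + (-zz n) ^ (k + 2) * (1 / (1 + zz n)) := by
          have h := geom_sum_mul_neg (-zz n) (k + 2)
          rw [Finset.sum_range_succ', sub_neg_eq_add, pow_zero] at h
          generalize (∑ i ∈ Finset.range (k + 1), (-zz n) ^ (i + 1)) = S at *
          field_simp
          linarith
        have hy : 1 / (4 * log (n:ℝ)) = yy n / 4 := by unfold yy; field_simp
        rw [hy]
        linear_combination (-(yy n) / 4) * hgeom
  · simp only [hU0]
    norm_num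
    rw [← Polynomial.C_mul]
    norm_num [sub_eq_add_neg]

end BA

/-- For every `m ≥ 2` there exist unique polynomials `V_2, …, V_m ∈ ℚ[X]` with
`deg V_s = s − 1` and positive leading coefficient realizing the asymptotic expansion of
`B_n = n·p_n/2 − ∑_{k≤n} p_k`; moreover `V_2(x) = x − 7/2`. -/
theorem B_asymptotic (m : ℕ) (hm : 2 ≤ m) :
    ∃ V : ℕ → Polynomial ℚ, IsBFamily m V ∧
      (∀ V' : ℕ → Polynomial ℚ, IsBFamily m V' →
        ∀ s ∈ Finset.Icc 2 m, V' s = V s) ∧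
      V 2 = X - C (7 / 2) := by
  obtain ⟨k, rfl⟩ := Nat.exists_eq_add_of_le' hm
  obtain ⟨V, hV, h2⟩ := BA.family_exists k
  exact ⟨V, hV, fun V' h' => BA.family_unique _ V V' hV h', h2⟩
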